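/- arXiv:1110.5007 — 3 statements merged into one kernel-verified Lean document; each statement's English description precedes it below -/
import Mathlib

section
/- Let 3 ≤ k ≤ n−1 and let H be the complete k-uniform hypergraph on {1,...,n}. Then dim HC_r(Δ(H)^C) = C(n−1, r+1) for all r with n−2 ≥ r > n−k, and dim HC_{n−k}(Δ(H)^C) = C(n−1, n−k−1) + C(n−1, n−k+1). -/
open Function

/-- The map `Fin (m+1) → Fin m` which merges the blocks `j` and `j+1` of an
ordered set partition with `m+1` blocks (blocks are indexed from `0`). -/
def mergeMap {m : ℕ} (j : Fin m) : Fin (m + 1) → Fin m := fun x =>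
  if h : (x : ℕ) ≤ (j : ℕ) then ⟨(x : ℕ), lt_of_le_of_lt h j.isLt⟩
  else ⟨(x : ℕ) - 1, by have h1 := x.isLt; have h2 := j.isLt; omega⟩

/-- The linear map between spaces of `R`-valued functions on finite bases
given by a "matrix" `M` (rows indexed by `α`, columns by `β`). -/
def matLin {R : Type} [CommRing R] {α β : Type} [Fintype α] (M : α → β → R) :
    (α → R) →ₗ[R] (β → R) where
  toFun c := fun b => ∑ a, c a * M a b
  map_add' x y := by
    funext b
    simp [add_mul, Finset.sum_add_distrib]
  map_smul' r x := by
    funext b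
    simp [Finset.mul_sum, mul_assoc]

/-- Homology of a (piece of a) chain complex: the kernel of the outgoing map `d1`
modulo the image of the incoming map `d2`. -/
abbrev homologyOf {R A B C : Type} [CommRing R] [AddCommGroup A] [AddCommGroup B] [AddCommGroup C]
    [Module R A] [Module R B] [Module R C] (d2 : A →ₗ[R] B) (d1 : B →ₗ[R] C) :=
  LinearMap.ker d1 ⧸ (LinearMap.range d2).comap (LinearMap.ker d1).subtype

/-- The canonical representatives of faces of the cyclic coloring complex:
ordered set partitions of `{0, …, n-1}` (vertex `i` stands for the vertex `i+1` of the paper)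
into `m` nonempty blocks, encoded as surjections `f : Fin n → Fin m` (block `B_{i+1}` is the
fiber `f⁻¹ i`), such that the block containing the vertex `0` is the first one, and
satisfying the extra condition `P m f` (used to encode hyperedge conditions). -/
def CycBas (n : ℕ) (P : (m : ℕ) → (Fin n → Fin m) → Prop) (m : ℕ) :=
  {f : Fin n → Fin m // Surjective f ∧ (∀ x : Fin n, (x : ℕ) = 0 → (f x : ℕ) = 0) ∧ P m f}

instance (n : ℕ) (P : (m : ℕ) → (Fin n → Fin m) → Prop) (m : ℕ) : Finite (CycBas n P m) := by
  unfold CycBas; infer_instance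

noncomputable instance (n : ℕ) (P : (m : ℕ) → (Fin n → Fin m) → Prop) (m : ℕ) :
    Fintype (CycBas n P m) := Fintype.ofFinite _

instance (n : ℕ) (P : (m : ℕ) → (Fin n → Fin m) → Prop) (m : ℕ) :
    DecidableEq (CycBas n P m) := by unfold CycBas; infer_instance

/-- The matrix of the boundary map of the cyclic coloring complex, from chains with `m+1`
blocks to chains with `m` blocks.  The first summand comes from merging consecutive blocks
`B_i, B_{i+1}` (`1 ≤ i ≤ r+1`, with sign `(-1)^{i+1}`), the second from merging `B_1` with the
last block `B_{r+2}` (with sign `(-1)^{r+3}`, and `r + 2 = m + 1`).  Terms whose merged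
partition does not satisfy the condition `P` do not appear (they match no element `g`). -/
def cycMat (n : ℕ) (P : (m : ℕ) → (Fin n → Fin m) → Prop) (m : ℕ)
    (f : CycBas n P (m + 1)) (g : CycBas n P m) : ℚ :=
  (∑ j : Fin m, (-1 : ℚ) ^ (j : ℕ) * (if mergeMap j ∘ f.1 = g.1 then 1 else 0))
    + (-1 : ℚ) ^ m * (if (∀ y : Fin n, ((f.1 y : ℕ) = m → (g.1 y : ℕ) = 0) ∧
        ((f.1 y : ℕ) ≠ m → (g.1 y : ℕ) = (f.1 y : ℕ))) then 1 else 0)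

/-- The boundary map of the cyclic coloring complex. -/
noncomputable def cycBnd (n : ℕ) (P : (m : ℕ) → (Fin n → Fin m) → Prop) (m : ℕ) :
    (CycBas n P (m + 1) → ℚ) →ₗ[ℚ] (CycBas n P m → ℚ) := matLin (cycMat n P m)

/-- Hyperedge condition for the complex `Δ(H)` where `H` is the complete `k`-uniform
hypergraph on `n` vertices: at least one block (= fiber of `f`) contains a hyperedge,
i.e. some `k`-element subset of the vertices lies inside one block. -/
def completeIn (n k : ℕ) : (m : ℕ) → (Fin n → Fin m) → Prop := fun m f =>
  ∃ e : Finset (Fin n), e.card = k ∧ ∃ i : Fin m, ∀ x ∈ e, f x = i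

/-- Hyperedge condition for the complex `Δ(H)` where `H` is the `k`-uniform star
hypergraph at the vertex `1` (encoded as the element of `Fin n` with value `0`):
some block contains a `k`-element set containing the vertex `1`. -/
def starIn (n k : ℕ) : (m : ℕ) → (Fin n → Fin m) → Prop := fun m f =>
  ∃ e : Finset (Fin n), e.card = k ∧ (∀ x : Fin n, (x : ℕ) = 0 → x ∈ e) ∧
    ∃ i : Fin m, ∀ x ∈ e, f x = i

/-- Condition for the quotient complex `Δ(H)^C` where `H` is the complete `k`-uniform
hypergraph: no block contains a hyperedge. -/
def completeFree (n k : ℕ) : (m : ℕ) → (Fin n → Fin m) → Prop := fun m f =>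
  ∀ e : Finset (Fin n), e.card = k → ∀ i : Fin m, ∃ x ∈ e, f x ≠ i

/-- Condition for the quotient complex `Δ(H')^C` where `H'` is the `k`-uniform star
hypergraph at the vertex `1`: no block contains a hyperedge of `H'`. -/
def starFree (n k : ℕ) : (m : ℕ) → (Fin n → Fin m) → Prop := fun m f =>
  ∀ e : Finset (Fin n), e.card = k → (∀ x : Fin n, (x : ℕ) = 0 → x ∈ e) →
    ∀ i : Fin m, ∃ x ∈ e, f x ≠ i

namespace CyclicColoring

/-- The faces of the full cyclic coloring complex on `N + 1` vertices with `M + 1` blocks. -/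
abbrev Cell (N M : ℕ) := {f : Fin (N + 1) → Fin (M + 1) // Surjective f ∧ f 0 = 0}

/-- Recolouring of blocks which merges the cyclically consecutive blocks `j` and `j + 1`. -/
def faceMap (M j : ℕ) (x : Fin (M + 2)) : Fin (M + 1) :=
  ⟨if j ≤ M then (if (x : ℕ) ≤ j then x else x - 1) else (if (x : ℕ) = M + 1 then 0 else x), by
    have := x.isLt
    split_ifs <;> omega⟩

lemma faceMap_val (M j : ℕ) (x : Fin (M + 2)) : (faceMap M j x : ℕ) =
    if j ≤ M then (if (x : ℕ) ≤ j then (x : ℕ) else x - 1)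
      else (if (x : ℕ) = M + 1 then 0 else (x : ℕ)) := rfl

lemma faceMap_surjective (M j : ℕ) : Surjective (faceMap M j) := by
  intro y
  have := y.isLt
  by_cases h : (y : ℕ) ≤ j
  · refine ⟨⟨y, by omega⟩, ?_⟩
    ext
    rw [faceMap_val]
    dsimp only
    split_ifs <;> omega
  · refine ⟨⟨y + 1, by omega⟩, ?_⟩
    ext
    rw [faceMap_val]
    dsimp only
    split_ifs <;> omega

/-- The face of a cell obtained by merging the blocks `j` and `j + 1` cyclically. -/
def face {N M : ℕ} (j : ℕ) (f : Cell N (M + 1)) : Cell N M :=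
  ⟨faceMap M j ∘ f.1, (faceMap_surjective M j).comp f.2.1, by
    ext
    simp [faceMap_val, f.2.2]⟩

lemma face_val {N M : ℕ} (j : ℕ) (f : Cell N (M + 1)) (x : Fin (N + 1)) :
    ((face j f).1 x : ℕ) = if j ≤ M then (if (f.1 x : ℕ) ≤ j then (f.1 x : ℕ) else f.1 x - 1)
      else (if (f.1 x : ℕ) = M + 1 then 0 else (f.1 x : ℕ)) := rfl

lemma cell_ext {N M : ℕ} {f g : Cell N M} (h : ∀ x, (f.1 x : ℕ) = g.1 x) : f = g :=
  Subtype.ext (funext fun x => Fin.ext (h x))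

lemma cell_zero {N M : ℕ} (f : Cell N M) : (f.1 0 : ℕ) = 0 := by simp [f.2.2]

lemma face_face {N M : ℕ} (f : Cell N (M + 2)) {i j : ℕ} (hij : i < j) (hj : j < M + 3) :
    face i (face j f) = face (j - 1) (face i f) := by
  apply cell_ext
  intro x
  have := (f.1 x).isLt
  simp only [face_val]
  split_ifs <;> omega

lemma alternating_double_sum (a : ℕ) (G : ℕ → ℕ → ℚ)
    (hG : ∀ i j, i < j → j < a + 1 → G i j = G (j - 1) i) :
    ∑ i ∈ Finset.range a, ∑ j ∈ Finset.range (a + 1), (-1 : ℚ) ^ i * ((-1) ^ j * G i j) = 0 := by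
  rw [← Finset.sum_product']
  refine Finset.sum_involution
    (fun p _ => if p.1 < p.2 then (p.2 - 1, p.1) else (p.2, p.1 + 1)) ?_ ?_ ?_ ?_
  · rintro ⟨i, j⟩ h
    simp only [Finset.mem_product, Finset.mem_range] at h
    by_cases hij : i < j
    · obtain ⟨j, rfl⟩ : ∃ j', j = j' + 1 := ⟨j - 1, by omega⟩
      simp only [hij, if_true, hG i (j + 1) hij h.2, Nat.add_sub_cancel]
      ring
    · simp only [hij, if_false, hG j (i + 1) (by omega) (by omega), Nat.add_sub_cancel]
      ring
  · rintro ⟨i, j⟩ h _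
    dsimp only
    split_ifs
    · simp only [ne_eq, Prod.mk.injEq]
      omega
    · simp only [ne_eq, Prod.mk.injEq]
      omega
  · rintro ⟨i, j⟩ h
    simp only [Finset.mem_product, Finset.mem_range] at h ⊢
    split_ifs <;> dsimp only <;> omega
  · rintro ⟨i, j⟩ h
    simp only [Finset.mem_product, Finset.mem_range] at h ⊢
    by_cases hij : i < j
    · simp only [hij, if_true]
      rw [if_neg (by omega)]
      simp only [Prod.mk.injEq, true_and]
      omega
    · simp only [hij, if_false]
      rw [if_pos (by omega)]
      simp

/-- The incidence matrix of the full cyclic coloring complex. -/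
def incidence (N M : ℕ) : Matrix (Cell N (M + 1)) (Cell N M) ℚ := fun f g =>
  ∑ j ∈ Finset.range (M + 2), (-1 : ℚ) ^ j * (if face j f = g then 1 else 0)

/-- The boundary map of the full cyclic coloring complex. -/
def bd (N M : ℕ) : (Cell N (M + 1) → ℚ) →ₗ[ℚ] (Cell N M → ℚ) := matLin (incidence N M)

/-- The coboundary map, dual to `bd`. -/
def cobd (N M : ℕ) : (Cell N M → ℚ) →ₗ[ℚ] (Cell N (M + 1) → ℚ) := (incidence N M).mulVecLin

lemma bd_apply {N M : ℕ} (c : Cell N (M + 1) → ℚ) (g : Cell N M) :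
    bd N M c g = ∑ f, c f * incidence N M f g := rfl

lemma bd_apply' {N M : ℕ} (c : Cell N (M + 1) → ℚ) (g : Cell N M) :
    bd N M c g = ∑ j ∈ Finset.range (M + 2), (-1 : ℚ) ^ j *
      ∑ f, if face j f = g then c f else 0 := by
  simp only [bd_apply, incidence, Finset.mul_sum]
  rw [Finset.sum_comm]
  refine Finset.sum_congr rfl fun j _ => Finset.sum_congr rfl fun f _ => ?_
  split_ifs <;> ring

lemma cobd_apply {N M : ℕ} (ψ : Cell N M → ℚ) (f : Cell N (M + 1)) :
    cobd N M ψ f = ∑ j ∈ Finset.range (M + 2), (-1 : ℚ) ^ j * ψ (face j f) := by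
  simp only [cobd, Matrix.mulVecLin_apply, Matrix.mulVec, dotProduct, incidence, Finset.sum_mul]
  rw [Finset.sum_comm]
  refine Finset.sum_congr rfl fun j _ => ?_
  simp

lemma pairing {N M : ℕ} (c : Cell N (M + 1) → ℚ) (ψ : Cell N M → ℚ) :
    ∑ g, bd N M c g * ψ g = ∑ f, c f * cobd N M ψ f := by
  simp only [bd_apply, cobd, Matrix.mulVecLin_apply, Matrix.mulVec, dotProduct, Finset.sum_mul,
    Finset.mul_sum]
  rw [Finset.sum_comm]
  simp only [mul_assoc]

lemma cobd_cobd {N M : ℕ} (ψ : Cell N M → ℚ) : cobd N (M + 1) (cobd N M ψ) = 0 := by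
  funext f
  simp only [cobd_apply, Pi.zero_apply, Finset.mul_sum]
  rw [Finset.sum_comm]
  have := alternating_double_sum (M + 2) (fun i j => ψ (face i (face j f)))
    (fun i j h1 h2 => by rw [face_face f h1 h2])
  rw [← this]
  refine Finset.sum_congr rfl fun i _ => Finset.sum_congr rfl fun j _ => ?_
  ring

lemma bd_bd {N M : ℕ} (c : Cell N (M + 2) → ℚ) : bd N M (bd N (M + 1) c) = 0 := by
  funext g
  have h := pairing (bd N (M + 1) c) (Pi.single g 1)
  rw [pairing c, cobd_cobd] at h
  simpa [Pi.single_apply] using h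

lemma finrank_range_bd_add (N M : ℕ) :
    Module.finrank ℚ (LinearMap.range (bd N M)) + Module.finrank ℚ (LinearMap.ker (cobd N M))
      = Fintype.card (Cell N M) := by
  have h1 : bd N M = (incidence N M).transpose.mulVecLin := by
    refine LinearMap.ext fun c => funext fun g => ?_
    simp [bd_apply, Matrix.vecMul, dotProduct]
  have h2 : Module.finrank ℚ (LinearMap.range (bd N M))
      = Module.finrank ℚ (LinearMap.range (cobd N M)) := by
    rw [h1]
    exact (incidence N M).rank_transpose
  rw [h2, LinearMap.finrank_range_add_finrank_ker, Module.finrank_fintype_fun_eq_card]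

/-! ### A matching of the cells -/

/-- A vertex outside the first block which is not a strict record of `f`. -/
def Bad {N M : ℕ} (f : Cell N M) (v : Fin (N + 1)) : Prop :=
  (f.1 v : ℕ) ≠ 0 ∧ ∃ w < v, (f.1 v : ℕ) ≤ f.1 w

/-- The largest bad vertex of a cell. -/
def IsPivot {N M : ℕ} (f : Cell N M) (p : Fin (N + 1)) : Prop :=
  Bad f p ∧ ∀ v, p < v → ¬ Bad f v

/-- The vertex `p` forms a block of its own. -/
def Alone {N M : ℕ} (f : Cell N M) (p : Fin (N + 1)) : Prop :=
  ∀ w, (f.1 w : ℕ) = f.1 p → w = p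

/-- Cells which get matched with a cell having one more block. -/
def Down {N M : ℕ} (f : Cell N M) : Prop := ∃ p, IsPivot f p ∧ ¬ Alone f p

/-- Cells which get matched with a cell having one block less. -/
def Up {N M : ℕ} (f : Cell N M) : Prop := ∃ p, IsPivot f p ∧ Alone f p

/-- Cells whose nonzero part is strictly increasing. -/
def Crit {N M : ℕ} (f : Cell N M) : Prop := ∀ v, ¬ Bad f v

lemma IsPivot.unique {N M : ℕ} {f : Cell N M} {p q : Fin (N + 1)} (hp : IsPivot f p)
    (hq : IsPivot f q) : p = q := by
  by_contra h
  rcases lt_or_gt_of_ne h with h | h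
  · exact hp.2 q h hq.1
  · exact hq.2 p h hp.1

lemma exists_isPivot {N M : ℕ} {f : Cell N M} (h : ¬ Crit f) : ∃ p, IsPivot f p := by
  classical
  have hne : (Finset.univ.filter (Bad f)).Nonempty := by
    unfold Crit at h
    push Not at h
    obtain ⟨v, hv⟩ := h
    exact ⟨v, by simpa using hv⟩
  refine ⟨(Finset.univ.filter (Bad f)).max' hne, ?_, fun v hv hb => ?_⟩
  · simpa using Finset.max'_mem _ hne
  · exact absurd (Finset.le_max' _ v (by simpa using hb)) (not_le.2 hv)

lemma exists_val_eq {N M : ℕ} (f : Cell N M) {i : ℕ} (hi : i ≤ M) :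
    ∃ x, (f.1 x : ℕ) = i := by
  obtain ⟨x, hx⟩ := f.2.1 ⟨i, by omega⟩
  exact ⟨x, by simp [hx]⟩

lemma IsPivot.lt_of_eq {N M : ℕ} {f : Cell N M} {p w : Fin (N + 1)} (hp : IsPivot f p)
    (hw : (f.1 w : ℕ) = f.1 p) (hne : w ≠ p) : w < p := by
  by_contra h
  have hlt : p < w := lt_of_le_of_ne (not_lt.1 h) hne.symm
  exact hp.2 w hlt ⟨by rw [hw]; exact hp.1.1, p, hlt, hw.le⟩

/-- Merging the singleton block of the pivot with the next block. -/
lemma isPivot_face {N M : ℕ} {f : Cell N (M + 1)} {p : Fin (N + 1)} (hp : IsPivot f p)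
    (ha : Alone f p) : IsPivot (face (f.1 p) f) p ∧ ¬ Alone (face (f.1 p) f) p ∧
      ((face (f.1 p) f).1 p : ℕ) = f.1 p := by
  obtain ⟨⟨h0, w, hwp, hw⟩, hmax⟩ := hp
  have hw' : (f.1 w : ℕ) ≠ f.1 p := fun h => hwp.ne (ha w h)
  have hM : (f.1 p : ℕ) ≤ M := by have := (f.1 w).isLt; omega
  have hval : ((face (f.1 p) f).1 p : ℕ) = f.1 p := by
    rw [face_val]; split_ifs <;> omega
  obtain ⟨y, hy⟩ := exists_val_eq f (i := f.1 p + 1) (by omega)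
  have hyval : ((face (f.1 p) f).1 y : ℕ) = f.1 p := by
    rw [face_val]; split_ifs <;> omega
  refine ⟨⟨⟨by omega, w, hwp, ?_⟩, fun v hv hb => ?_⟩, fun h => ?_, hval⟩
  · rw [hval, face_val]; split_ifs <;> omega
  · obtain ⟨hb0, u, huv, hu⟩ := hb
    have key : ¬ Bad f v := hmax v hv
    unfold Bad at key
    push Not at key
    have hfv : (f.1 v : ℕ) ≠ 0 := by
      intro h
      apply hb0
      rw [face_val, h]
      simp [hM]
    have h1 := key hfv u huv
    have h2 := key hfv p hv
    have h3 := key hfv w (hwp.trans hv)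
    simp only [face_val] at hu
    split_ifs at hu <;> omega
  · have := h y (hyval.trans hval.symm)
    subst this
    omega

lemma Up.face_injective {N M : ℕ} {f f' : Cell N (M + 1)} {p p' : Fin (N + 1)}
    (hp : IsPivot f p) (ha : Alone f p) (hp' : IsPivot f' p') (ha' : Alone f' p')
    (h : face (f.1 p) f = face (f'.1 p') f') : f = f' := by
  obtain ⟨h1, h2, h3⟩ := isPivot_face hp ha
  obtain ⟨h1', h2', h3'⟩ := isPivot_face hp' ha'
  rw [← h] at h1' h3'
  obtain rfl := h1.unique h1'
  have hv : (f.1 p : ℕ) = f'.1 p := h3.symm.trans h3'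
  apply cell_ext
  intro x
  by_cases hx : x = p
  · rw [hx, hv]
  have e1 : (f.1 x : ℕ) ≠ f.1 p := fun h => hx (ha x h)
  have e2 : (f'.1 x : ℕ) ≠ f'.1 p := fun h => hx (ha' x h)
  have e3 : ((face (f.1 p) f).1 x : ℕ) = (face (f'.1 p) f').1 x := by rw [h]
  have := (f.1 x).isLt
  have := (f'.1 x).isLt
  have hM : (f.1 p : ℕ) ≤ M := by
    by_contra hc
    obtain ⟨-, w, hw, hw'⟩ := hp.1
    have := (f.1 w).isLt
    have := (f.1 p).isLt
    exact hw.ne (ha w (by omega))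
  simp only [face_val] at e3
  split_ifs at e3 <;> omega

/-- Splitting the pivot off its block, to the left. -/
lemma exists_mate {N M : ℕ} {g : Cell N M} {p : Fin (N + 1)} (hp : IsPivot g p)
    (ha : ¬ Alone g p) : ∃ f : Cell N (M + 1), face (g.1 p) f = g ∧
      (∀ x, (f.1 x : ℕ) = if x = p then (g.1 p : ℕ) else
        if (g.1 p : ℕ) ≤ g.1 x then (g.1 x : ℕ) + 1 else g.1 x) := by
  have hpos : 0 < (g.1 p : ℕ) := Nat.pos_of_ne_zero hp.1.1
  let F : Fin (N + 1) → Fin (M + 2) := fun x =>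
    ⟨if x = p then (g.1 p : ℕ) else if (g.1 p : ℕ) ≤ g.1 x then (g.1 x : ℕ) + 1 else g.1 x, by
      have := (g.1 x).isLt
      have := (g.1 p).isLt
      split_ifs <;> omega⟩
  have hF : ∀ x, (F x : ℕ) = if x = p then (g.1 p : ℕ) else
        if (g.1 p : ℕ) ≤ g.1 x then (g.1 x : ℕ) + 1 else g.1 x := fun x => rfl
  have hsurj : Surjective F := by
    intro y
    have hy := y.isLt
    rcases lt_trichotomy (y : ℕ) (g.1 p) with h | h | h
    · obtain ⟨x, hx⟩ := exists_val_eq g (i := y) (by omega)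
      refine ⟨x, Fin.ext ?_⟩
      rw [hF, if_neg, if_neg, hx]
      · omega
      · rintro rfl; omega
    · exact ⟨p, Fin.ext (by rw [hF, if_pos rfl, h])⟩
    · by_cases h1 : (y : ℕ) = g.1 p + 1
      · unfold Alone at ha
        push Not at ha
        obtain ⟨w, hw, hne⟩ := ha
        exact ⟨w, Fin.ext (by rw [hF, if_neg hne, if_pos hw.ge, hw, h1])⟩
      · obtain ⟨x, hx⟩ := exists_val_eq g (i := y - 1) (by omega)
        refine ⟨x, Fin.ext ?_⟩
        rw [hF, if_neg, if_pos] <;> try omega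
        rintro rfl
        omega
  have h0 : F 0 = 0 := by
    apply Fin.ext
    have := cell_zero g
    have hp0 : (0 : Fin (N + 1)) ≠ p := by
      rintro rfl
      omega
    rw [hF, if_neg hp0, if_neg (by omega), this]
    rfl
  refine ⟨⟨F, hsurj, h0⟩, ?_, hF⟩
  apply cell_ext
  intro x
  rw [face_val]
  change (if (g.1 p : ℕ) ≤ M then (if (F x : ℕ) ≤ g.1 p then (F x : ℕ) else F x - 1)
    else (if (F x : ℕ) = M + 1 then 0 else (F x : ℕ))) = _
  have := (g.1 p).isLt
  have e := hF x
  by_cases hx : x = p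
  · rw [if_pos hx] at e
    rw [hx] at e ⊢
    split_ifs <;> omega
  · rw [if_neg hx] at e
    split_ifs at e ⊢ <;> omega

/-- The number of vertices outside the first block. -/
def outer {N M : ℕ} (f : Cell N M) : ℕ := (Finset.univ.filter fun x => (f.1 x : ℕ) ≠ 0).card

lemma eq_zero_of_down {N M : ℕ} (ψ : Cell N M → ℚ) (hψ : cobd N M ψ = 0)
    (h0 : ∀ g, ¬ Down g → ψ g = 0) : ∀ a b c : ℕ, ∀ g p, IsPivot g p → ¬ Alone g p →
      outer g = a → N - (p : ℕ) = b → (g.1 p : ℕ) = c → ψ g = 0 := by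
  intro a
  induction a using Nat.strong_induction_on with | _ a iha => ?_
  intro b
  induction b using Nat.strong_induction_on with | _ b ihb => ?_
  intro c
  induction c using Nat.strong_induction_on with | _ c ihc => ?_
  intro g p hp ha hga hpb hgc
  obtain ⟨f, hf, hfx⟩ := exists_mate hp ha
  have hpos : 0 < (g.1 p : ℕ) := Nat.pos_of_ne_zero hp.1.1
  have hplt := (g.1 p).isLt
  have hfp : (f.1 p : ℕ) = g.1 p := by rw [hfx, if_pos rfl]
  have hfg0 : ∀ x, (f.1 x : ℕ) = 0 ↔ (g.1 x : ℕ) = 0 := by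
    intro x
    rw [hfx]
    by_cases hx : x = p
    · subst hx; simp
    · rw [if_neg hx]
      by_cases hc : (g.1 p : ℕ) ≤ g.1 x
      · rw [if_pos hc]
        omega
      · rw [if_neg hc]
  have halone : Alone f p := by
    intro w hw
    by_contra hne
    rw [hfx, if_neg hne, hfp] at hw
    split_ifs at hw <;> omega
  have hbad : ∃ w < p, (f.1 p : ℕ) ≤ f.1 w := by
    unfold Alone at ha
    push Not at ha
    obtain ⟨w, hw, hne⟩ := ha
    refine ⟨w, hp.lt_of_eq hw hne, ?_⟩
    rw [hfp, hfx, if_neg hne]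
    split_ifs <;> omega
  have key : ∀ j ∈ Finset.range (M + 2), j ≠ (g.1 p : ℕ) → ψ (face j f) = 0 := by
    intro j hj hjne
    rw [Finset.mem_range] at hj
    by_cases hD : Down (face j f)
    swap
    · exact h0 _ hD
    obtain ⟨q, hq, hqa⟩ := hD
    have hface0 : ∀ x, (g.1 x : ℕ) = 0 → ((face j f).1 x : ℕ) = 0 := by
      intro x hx
      rw [face_val, (hfg0 x).2 hx]
      simp
    by_cases hj' : 1 ≤ j ∧ j ≤ M
    · have hcard : outer (face j f) = a := by
        rw [← hga]
        unfold outer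
        congr 1
        ext x
        simp only [Finset.mem_filter, Finset.mem_univ, true_and, not_iff_not]
        refine ⟨fun h => ?_, hface0 x⟩
        rw [← hfg0]
        rw [face_val] at h
        split_ifs at h <;> omega
      have hbadp : Bad (face j f) p := by
        obtain ⟨w, hw, hle⟩ := hbad
        refine ⟨?_, w, hw, ?_⟩
        · rw [face_val]; split_ifs <;> omega
        · rw [face_val, face_val]; split_ifs <;> omega
      have hpq : p ≤ q := by
        by_contra h
        exact hq.2 p (not_le.1 h) hbadp
      rcases hpq.lt_or_eq with hlt | rfl
      · refine ihb (N - (q : ℕ)) ?_ _ _ q hq hqa hcard rfl rfl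
        have := q.isLt
        have : (p : ℕ) < q := hlt
        omega
      · refine ihc _ ?_ _ p hq hqa hcard hpb rfl
        unfold Alone at hqa
        push Not at hqa
        obtain ⟨w, hw, hne⟩ := hqa
        have hw' : (f.1 w : ℕ) ≠ f.1 p := fun h => hne (halone w h)
        rw [face_val, face_val] at hw
        rw [face_val]
        split_ifs at hw ⊢ <;> omega
    · refine iha _ ?_ _ _ _ q hq hqa rfl rfl rfl
      rw [← hga]
      apply Finset.card_lt_card
      rw [Finset.ssubset_iff_of_subset]
      · by_cases hj0 : j = 0
        · obtain ⟨y, hy⟩ := exists_val_eq f (i := 1) (by omega)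
          refine ⟨y, ?_, ?_⟩
          · simp only [Finset.mem_filter, Finset.mem_univ, true_and]
            intro h
            have := (hfg0 y).2 h
            omega
          · simp only [Finset.mem_filter, Finset.mem_univ, true_and, not_not]
            rw [face_val]
            split_ifs <;> omega
        · obtain ⟨y, hy⟩ := exists_val_eq f (i := M + 1) (by omega)
          refine ⟨y, ?_, ?_⟩
          · simp only [Finset.mem_filter, Finset.mem_univ, true_and]
            intro h
            have := (hfg0 y).2 h
            omega
          · simp only [Finset.mem_filter, Finset.mem_univ, true_and, not_not]
            rw [face_val]
            split_ifs <;> omega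
      · intro x
        simp only [Finset.mem_filter, Finset.mem_univ, true_and]
        exact fun h h' => h (hface0 x h')
  have hsum := congrFun hψ f
  rw [cobd_apply, Finset.sum_eq_single (g.1 p : ℕ)
    (fun j hj hne => by rw [key j hj hne, mul_zero])
    (fun h => absurd (Finset.mem_range.2 (by omega)) h), hf] at hsum
  simpa using hsum

lemma card_down_le (N M : ℕ) :
    Nat.card {g : Cell N M // Down g} ≤ Module.finrank ℚ (LinearMap.range (bd N M)) := by
  classical
  have h := finrank_range_bd_add N M
  have h1 : Module.finrank ℚ (LinearMap.ker (cobd N M)) ≤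
      Fintype.card {g : Cell N M // ¬ Down g} := by
    rw [← Module.finrank_fintype_fun_eq_card (R := ℚ)]
    let L : LinearMap.ker (cobd N M) →ₗ[ℚ] ({g : Cell N M // ¬ Down g} → ℚ) :=
      (LinearMap.funLeft ℚ ℚ Subtype.val).comp (LinearMap.ker (cobd N M)).subtype
    refine LinearMap.finrank_le_finrank_of_injective (f := L) ?_
    rw [injective_iff_map_eq_zero]
    rintro ⟨ψ, hψ⟩ h0
    have h0' : ∀ g, ¬ Down g → ψ g = 0 := fun g hg => congrFun h0 ⟨g, hg⟩
    ext g
    by_cases hg : Down g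
    · obtain ⟨p, hp, ha⟩ := hg
      exact eq_zero_of_down ψ hψ h0' _ _ _ g p hp ha rfl rfl rfl
    · exact h0' g hg
  have h2 := Fintype.card_subtype_compl (fun g : Cell N M => Down g)
  have h3 := Fintype.card_subtype_le (fun g : Cell N M => Down g)
  rw [Nat.card_eq_fintype_card]
  omega

lemma card_up_le (N M : ℕ) :
    Nat.card {f : Cell N (M + 1) // Up f} ≤ Nat.card {g : Cell N M // Down g} := by
  choose! p hp using fun (f : Cell N (M + 1)) (hf : Up f) => hf
  refine Nat.card_le_card_of_injective
    (fun f => ⟨face (f.1.1 (p f.1)) f.1, p f.1, ?_, ?_⟩) ?_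
  · exact (isPivot_face (hp f.1 f.2).1 (hp f.1 f.2).2).1
  · exact (isPivot_face (hp f.1 f.2).1 (hp f.1 f.2).2).2.1
  · intro f f' h
    exact Subtype.ext (Up.face_injective (hp f.1 f.2).1 (hp f.1 f.2).2 (hp f'.1 f'.2).1
      (hp f'.1 f'.2).2 (congrArg Subtype.val h))

/-- Two strictly increasing functions on a finite set with the same image agree. -/
lemma eqOn_of_strictMonoOn {α β : Type} [LinearOrder α] [LinearOrder β] [Finite α]
    {f g : α → β} {T : Set α} (hf : StrictMonoOn f T) (hg : StrictMonoOn g T)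
    (h : f '' T = g '' T) : Set.EqOn f g T := by
  have h1 : StrictMono (T.domRestrict f) := fun a b hab => hf a.2 b.2 hab
  have h2 : StrictMono (T.domRestrict g) := fun a b hab => hg a.2 b.2 hab
  have h3 : Set.range (T.domRestrict f) = Set.range (T.domRestrict g) := by
    simpa [Set.range_domRestrict] using h
  have := (StrictMono.range_inj h1 h2).1 h3
  intro x hx
  exact congrFun this ⟨x, hx⟩

lemma Crit.strictMonoOn {N M : ℕ} {f : Cell N M} (hf : Crit f) :
    StrictMonoOn f.1 {x | f.1 x ≠ 0} := by
  intro a _ b hb hab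
  have := hf b
  unfold Bad at this
  push Not at this
  exact this (fun h => hb (Fin.ext h)) a hab

lemma image_ne_zero {N M : ℕ} (f : Cell N M) : f.1 '' {x | f.1 x ≠ 0} = {i | i ≠ 0} := by
  ext i
  constructor
  · rintro ⟨x, hx, rfl⟩
    exact hx
  · intro hi
    obtain ⟨x, rfl⟩ := f.2.1 i
    exact ⟨x, hi, rfl⟩

lemma card_crit_le (N M : ℕ) : Nat.card {f : Cell N M // Crit f} ≤ N.choose M := by
  classical
  have hc : ∀ f : Cell N M, Crit f →
      (Finset.univ.filter fun i : Fin N => f.1 i.succ ≠ 0).card = M := by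
    intro f hf
    have h1 : (Finset.univ.filter fun i : Fin N => f.1 i.succ ≠ 0).card
        = (Finset.univ.filter fun i : Fin (M + 1) => i ≠ 0).card := by
      refine Finset.card_bij (fun i _ => f.1 i.succ) ?_ ?_ ?_
      · simp
      · intro a ha b hb hab
        simp only [Finset.mem_filter, Finset.mem_univ, true_and] at ha hb
        exact Fin.succ_injective _ (hf.strictMonoOn.injOn ha hb hab)
      · intro i hi
        simp only [Finset.mem_filter, Finset.mem_univ, true_and] at hi
        obtain ⟨x, hx⟩ := f.2.1 i
        have hx0 : x ≠ 0 := by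
          rintro rfl
          exact hi (hx.symm.trans f.2.2)
        obtain ⟨y, rfl⟩ := Fin.exists_succ_eq.2 hx0
        exact ⟨y, by simpa [hx] using hi, hx⟩
    rw [h1, Finset.filter_ne', Finset.card_erase_of_mem (Finset.mem_univ _)]
    simp
  have : N.choose M = Nat.card {T : Finset (Fin N) // T.card = M} := by
    rw [Nat.card_eq_fintype_card, Fintype.card_finset_len, Fintype.card_fin]
  rw [this]
  refine Nat.card_le_card_of_injective (fun f => ⟨_, hc f.1 f.2⟩) ?_
  rintro ⟨f, hf⟩ ⟨f', hf'⟩ h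
  have h' : ∀ x, f.1 x ≠ 0 ↔ f'.1 x ≠ 0 := by
    intro x
    refine Fin.cases ?_ (fun i => ?_) x
    · simp [f.2.2, f'.2.2]
    · have := congrArg (fun T => i ∈ T.1) h
      simpa using this
  have hset : {x | f.1 x ≠ 0} = {x | f'.1 x ≠ 0} := Set.ext h'
  have heq : Set.EqOn f.1 f'.1 {x | f.1 x ≠ 0} := by
    refine eqOn_of_strictMonoOn hf.strictMonoOn (hset ▸ hf'.strictMonoOn) ?_
    rw [image_ne_zero f, hset, image_ne_zero f']
  apply Subtype.ext
  apply Subtype.ext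
  funext x
  by_cases hx : f.1 x = 0
  · have : f'.1 x = 0 := by
      by_contra hc
      exact (h' x).2 hc hx
    rw [hx, this]
  · exact heq hx

lemma card_cell_le (N M : ℕ) : Fintype.card (Cell N (M + 1)) ≤
    N.choose (M + 1) + Module.finrank ℚ (LinearMap.range (bd N M))
      + Module.finrank ℚ (LinearMap.range (bd N (M + 1))) := by
  classical
  have h1 := card_down_le N (M + 1)
  have h2 := (card_up_le N M).trans (card_down_le N M)
  have h3 := card_crit_le N (M + 1)
  have h4 : Fintype.card (Cell N (M + 1)) ≤ Nat.card {f : Cell N (M + 1) // Crit f}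
      + Nat.card {f : Cell N (M + 1) // Up f} + Nat.card {f : Cell N (M + 1) // Down f} := by
    have e : ∀ P : Cell N (M + 1) → Prop,
        Nat.card {f // P f} = (Finset.univ.filter P).card := fun P => by
      rw [Nat.card_eq_fintype_card, Fintype.card_subtype]
    rw [e, e, e, ← Finset.card_univ]
    have : (Finset.univ : Finset (Cell N (M + 1))) ⊆ (Finset.univ.filter Crit
        ∪ Finset.univ.filter Up) ∪ Finset.univ.filter Down := by
      intro f _
      simp only [Finset.mem_union, Finset.mem_filter, Finset.mem_univ, true_and]
      by_cases hc : Crit f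
      · exact Or.inl (Or.inl hc)
      · obtain ⟨p, hp⟩ := exists_isPivot hc
        by_cases ha : Alone f p
        · exact Or.inl (Or.inr ⟨p, hp, ha⟩)
        · exact Or.inr ⟨p, hp, ha⟩
    calc _ ≤ _ := Finset.card_le_card this
      _ ≤ _ := (Finset.card_union_le _ _).trans (Nat.add_le_add_right (Finset.card_union_le _ _) _)
  omega

/-! ### Alternating chains are cycles -/

/-- Recolouring of the blocks of a cell by a permutation fixing the first block. -/
def recolor {N M : ℕ} (σ : Equiv.Perm (Fin (M + 1))) (hσ : σ 0 = 0) : Cell N M ≃ Cell N M where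
  toFun f := ⟨σ ∘ f.1, σ.surjective.comp f.2.1, by simp [f.2.2, hσ]⟩
  invFun f := ⟨σ.symm ∘ f.1, σ.symm.surjective.comp f.2.1, by
    simp [f.2.2, Equiv.symm_apply_eq, hσ]⟩
  left_inv f := by
    apply Subtype.ext
    funext x
    simp
  right_inv f := by
    apply Subtype.ext
    funext x
    simp

lemma recolor_val {N M : ℕ} (σ : Equiv.Perm (Fin (M + 1))) (hσ : σ 0 = 0) (f : Cell N M)
    (x : Fin (N + 1)) : (recolor σ hσ f).1 x = σ (f.1 x) := rfl

/-- The transposition of `j` and `j + 1`. -/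
def adjSwap (M : ℕ) {j : ℕ} (hj : j < M + 1) : Equiv.Perm (Fin (M + 2)) :=
  Equiv.swap ⟨j, by omega⟩ ⟨j + 1, by omega⟩

lemma adjSwap_val {M j : ℕ} (hj : j < M + 1) (x : Fin (M + 2)) : (adjSwap M hj x : ℕ) =
    if (x : ℕ) = j then j + 1 else if (x : ℕ) = j + 1 then j else (x : ℕ) := by
  unfold adjSwap
  rw [Equiv.swap_apply_def]
  simp only [Fin.ext_iff]
  split_ifs <;> rfl

lemma adjSwap_zero {M j : ℕ} (hj : j < M + 1) (h0 : 0 < j) : adjSwap M hj 0 = 0 := by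
  apply Fin.ext
  have h : ((0 : Fin (M + 2)) : ℕ) = 0 := rfl
  rw [adjSwap_val, h, if_neg (by omega), if_neg (by omega)]

lemma sign_adjSwap {M j : ℕ} (hj : j < M + 1) : Equiv.Perm.sign (adjSwap M hj) = -1 := by
  apply Equiv.Perm.sign_swap
  simp [Fin.ext_iff]

/-- The cyclic rotation of the nonzero elements. -/
def rot (M : ℕ) : Equiv.Perm (Fin (M + 2)) :=
  Equiv.Perm.decomposeFin.symm (0, finRotate (M + 1))

lemma rot_zero (M : ℕ) : rot M 0 = 0 := by simp [rot]

lemma rot_val (M : ℕ) (x : Fin (M + 2)) : (rot M x : ℕ) =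
    if (x : ℕ) = 0 then (0 : ℕ) else if (x : ℕ) = M + 1 then (1 : ℕ) else (x : ℕ) + 1 := by
  refine Fin.cases ?_ (fun i => ?_) x
  · simp [rot_zero]
  · have : rot M i.succ = (finRotate (M + 1) i).succ := by simp [rot]
    rw [this]
    have hi := i.isLt
    simp only [Fin.val_succ]
    by_cases h : (i : ℕ) = M
    · have : i = Fin.last M := Fin.ext h
      subst this
      simp
    · rw [coe_finRotate_of_ne_last (fun hc => h (by simp [hc])), if_neg (by omega),
        if_neg (by omega)]

lemma sign_rot (M : ℕ) : Equiv.Perm.sign (rot M) = (-1) ^ M := by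
  simp [rot, Equiv.Perm.decomposeFin.symm_sign, sign_finRotate]

lemma bd_eq_zero_of_alternating {N M : ℕ} (c : Cell N (M + 1) → ℚ)
    (hc : ∀ (σ : Equiv.Perm (Fin (M + 2))) (hσ : σ 0 = 0) (f : Cell N (M + 1)),
      c (recolor σ hσ f) = ((Equiv.Perm.sign σ : ℤ) : ℚ) * c f) : bd N M c = 0 := by
  funext g
  rw [bd_apply', Finset.sum_range_succ, Finset.sum_range_succ']
  have h1 : ∀ j ∈ Finset.range M, (-1 : ℚ) ^ (j + 1) *
      ∑ f, (if face (j + 1) f = g then c f else 0) = 0 := by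
    intro j hj
    rw [Finset.mem_range] at hj
    have hj' : j + 1 < M + 1 := by omega
    have key : ∑ f, (if face (j + 1) f = g then c f else 0)
        = -∑ f, (if face (j + 1) f = g then c f else 0) := by
      conv_lhs => rw [← (recolor (adjSwap M hj') (adjSwap_zero hj' (by omega))).sum_comp]
      rw [← Finset.sum_neg_distrib]
      refine Finset.sum_congr rfl fun f _ => ?_
      have hf : face (j + 1) (recolor (adjSwap M hj') (adjSwap_zero hj' (by omega)) f)
          = face (j + 1) f := by
        apply cell_ext
        intro x
        simp only [face_val, recolor_val, adjSwap_val]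
        split_ifs <;> omega
      rw [hf, hc, sign_adjSwap]
      split_ifs <;> simp
    have : ∑ f, (if face (j + 1) f = g then c f else 0) = 0 := by linarith
    rw [this, mul_zero]
  have h2 : ∑ f, (if face 0 f = g then c f else 0)
      = (-1) ^ M * ∑ f, (if face (M + 1) f = g then c f else 0) := by
    rw [← (recolor (rot M) (rot_zero M)).sum_comp, Finset.mul_sum]
    refine Finset.sum_congr rfl fun f _ => ?_
    have hf : face 0 (recolor (rot M) (rot_zero M) f) = face (M + 1) f := by
      apply cell_ext
      intro x
      have := (f.1 x).isLt
      simp only [face_val, recolor_val, rot_val]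
      split_ifs <;> omega
    rw [hf, hc, sign_rot]
    split_ifs <;> simp
  rw [Finset.sum_eq_zero h1, h2]
  simp only [Pi.zero_apply]
  ring

/-! ### Determinants -/

/-- The sign of a self-map of `Fin m`, which is zero if the map is not bijective. -/
def permDet {m : ℕ} (g : Fin m → Fin m) : ℚ :=
  (Matrix.of fun i j => if g j = i then (1 : ℚ) else 0).det

lemma permDet_id {m : ℕ} : permDet (id : Fin m → Fin m) = 1 := by
  have h : (Matrix.of fun i j : Fin m => if id j = i then (1 : ℚ) else 0) = 1 := by
    ext i j
    simp [Matrix.one_apply, eq_comm]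
  unfold permDet
  rw [h, Matrix.det_one]

lemma permDet_of_not_injective {m : ℕ} {g : Fin m → Fin m} {a b : Fin m} (hab : a ≠ b)
    (h : g a = g b) : permDet g = 0 := by
  refine Matrix.det_zero_of_column_eq hab fun i => ?_
  simp [h]

lemma permDet_comp {m : ℕ} (σ : Equiv.Perm (Fin m)) (g : Fin m → Fin m) :
    permDet (σ ∘ g) = ((Equiv.Perm.sign σ : ℤ) : ℚ) * permDet g := by
  have h := Matrix.det_permute σ⁻¹ (Matrix.of fun i j => if g j = i then (1 : ℚ) else 0)
  rw [Equiv.Perm.sign_inv] at h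
  unfold permDet
  rw [← h]
  congr 1
  ext i j
  simp only [Matrix.of_apply, Matrix.submatrix_apply, comp_apply, id]
  congr 1
  rw [eq_iff_iff, Equiv.Perm.eq_inv_iff_eq]

lemma sum_telescope (D : ℕ → ℚ) (K : ℕ) :
    ∑ j ∈ Finset.range K, (-1 : ℚ) ^ j * (D j + D (j + 1)) = D 0 - (-1) ^ K * D K := by
  induction K with
  | zero => simp
  | succ K ih =>
    rw [Finset.sum_range_succ, ih]
    ring

/-- The cochain measuring the arrangement of the vertices `ρ 0, …, ρ M`. -/
def detCochain {N M : ℕ} (ρ : Fin (M + 1) → Fin (N + 1)) (f : Cell N M) : ℚ := permDet (f.1 ∘ ρ)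

lemma cobd_detCochain {N M : ℕ} (ρ : Fin (M + 1) → Fin (N + 1)) (hρ : ρ 0 = 0) :
    cobd N M (detCochain ρ) = 0 := by
  funext f
  let r : ℕ → Fin (M + 1) → ℚ := fun k c => if (f.1 (ρ c) : ℕ) = k then 1 else 0
  let A : ℕ → Matrix (Fin (M + 1)) (Fin (M + 1)) ℚ := fun j =>
    Matrix.of fun i => r (if (i : ℕ) < j then i else i + 1)
  have hA : ∀ j i c, A j i c =
    if (f.1 (ρ c) : ℕ) = (if (i : ℕ) < j then (i : ℕ) else i + 1) then 1 else 0 := fun _ _ _ => rfl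
  have hr : ∀ k c, r k c = if (f.1 (ρ c) : ℕ) = k then 1 else 0 := fun _ _ => rfl
  have h0 : (f.1 (ρ 0) : ℕ) = 0 := by rw [hρ]; exact cell_zero f
  have hD0 : (A 0).det = 0 := by
    refine Matrix.det_eq_zero_of_column_eq_zero 0 fun i => ?_
    rw [hA, h0]
    simp
  have hmid : ∀ j ∈ Finset.range (M + 1), (-1 : ℚ) ^ j * detCochain ρ (face j f)
      = (-1) ^ j * ((A j).det + (A (j + 1)).det) := by
    intro j hj
    rw [Finset.mem_range] at hj
    congr 1
    have e1 : (Matrix.of fun i c => if ((face j f).1 ∘ ρ) c = i then (1 : ℚ) else 0)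
        = (A (j + 1)).updateRow ⟨j, hj⟩ (r (j + 1) + r j) := by
      ext i c
      rw [Matrix.updateRow_apply]
      simp only [Matrix.of_apply, Pi.add_apply, hA, hr, Fin.ext_iff, comp_apply, face_val]
      split_ifs <;> first | omega | norm_num
    have e2 : (A (j + 1)).updateRow ⟨j, hj⟩ (r (j + 1)) = A j := by
      ext i c
      rw [Matrix.updateRow_apply]
      simp only [hA, hr, Fin.ext_iff]
      split_ifs <;> first | omega | norm_num
    have e3 : (A (j + 1)).updateRow ⟨j, hj⟩ (r j) = A (j + 1) := by
      ext i c
      rw [Matrix.updateRow_apply]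
      simp only [hA, hr, Fin.ext_iff]
      split_ifs <;> first | omega | norm_num
    unfold detCochain permDet
    rw [e1, Matrix.det_updateRow_add, e2, e3]
  have hlast : detCochain ρ (face (M + 1) f) = (A (M + 1)).det := by
    have e1 : (Matrix.of fun i c => if ((face (M + 1) f).1 ∘ ρ) c = i then (1 : ℚ) else 0)
        = (A (M + 1)).updateRow 0 (r 0 + r (M + 1)) := by
      ext i c
      rw [Matrix.updateRow_apply]
      have := i.isLt
      simp only [Matrix.of_apply, Pi.add_apply, hA, hr, Fin.ext_iff, comp_apply, face_val,
        Fin.val_zero]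
      split_ifs <;> first | omega | norm_num
    have e2 : (A (M + 1)).updateRow 0 (r 0) = A (M + 1) := by
      ext i c
      rw [Matrix.updateRow_apply]
      simp only [hA, hr, Fin.ext_iff, Fin.val_zero]
      split_ifs <;> first | omega | norm_num
    have e3 : ((A (M + 1)).updateRow 0 (r (M + 1))).det = 0 := by
      refine Matrix.det_eq_zero_of_column_eq_zero 0 fun i => ?_
      rw [Matrix.updateRow_apply]
      have := i.isLt
      simp only [hA, hr, Fin.ext_iff, Fin.val_zero, h0]
      split_ifs <;> first | contradiction | omega | norm_num
    unfold detCochain permDet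
    rw [e1, Matrix.det_updateRow_add, e2, e3, add_zero]
  rw [cobd_apply, Finset.sum_range_succ, Finset.sum_congr rfl hmid,
    sum_telescope (fun j => (A j).det), hlast, hD0]
  simp

/-- Alternating chain supported on the cells having `S` inside one block. -/
def altChain {N M : ℕ} (ρ : Fin (M + 1) → Fin (N + 1)) (S : Finset (Fin (N + 1))) (f : Cell N M) :
    ℚ :=
  open Classical in if ∀ x ∈ S, ∀ y ∈ S, f.1 x = f.1 y then detCochain ρ f else 0

lemma bd_altChain {N M : ℕ} (ρ : Fin (M + 2) → Fin (N + 1)) (S : Finset (Fin (N + 1))) :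
    bd N M (altChain ρ S) = 0 := by
  refine bd_eq_zero_of_alternating _ fun σ hσ f => ?_
  unfold altChain
  simp only [recolor_val, EmbeddingLike.apply_eq_iff_eq]
  split_ifs
  · exact permDet_comp σ (f.1 ∘ ρ)
  · simp

/-! ### Reference cells -/

/-- `f` is constant on `S`. -/
def ConstOn {N M : ℕ} (f : Cell N M) (S : Finset (Fin (N + 1))) : Prop :=
  ∀ x ∈ S, ∀ y ∈ S, f.1 x = f.1 y

lemma altChain_of_constOn {N M : ℕ} {ρ : Fin (M + 1) → Fin (N + 1)} {S : Finset (Fin (N + 1))}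
    {f : Cell N M} (h : ConstOn f S) : altChain ρ S f = detCochain ρ f := if_pos h

lemma altChain_of_not_constOn {N M : ℕ} {ρ : Fin (M + 1) → Fin (N + 1)} {S : Finset (Fin (N + 1))}
    {f : Cell N M} (h : ¬ ConstOn f S) : altChain ρ S f = 0 := if_neg h

lemma ConstOn.injOn {N p : ℕ} {f : Cell N p} {S : Finset (Fin (N + 1))} (h : ConstOn f S)
    (hS : S.card + p = N + 1) {s : Fin (N + 1)} (hs : s ∈ S) :
    Set.InjOn f.1 (insert s Sᶜ : Finset (Fin (N + 1))) := by
  apply Finset.injOn_of_card_image_eq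
  have h1 : (insert s Sᶜ).image f.1 = Finset.univ := by
    apply Finset.eq_univ_of_forall
    intro i
    obtain ⟨x, rfl⟩ := f.2.1 i
    rw [Finset.mem_image]
    by_cases hx : x ∈ S
    · exact ⟨s, by simp, h s hs x hx⟩
    · exact ⟨x, by simp [hx], rfl⟩
  rw [h1, Finset.card_univ, Fintype.card_fin, Finset.card_insert_of_notMem (by simpa using hs),
    Finset.card_compl, Fintype.card_fin]
  omega

lemma ConstOn.eq_of_notMem {N p : ℕ} {f : Cell N p} {S : Finset (Fin (N + 1))} (h : ConstOn f S)
    (hS : S.card + p = N + 1) (hne : S.Nonempty) {x y : Fin (N + 1)} (hx : x ∉ S)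
    (hxy : f.1 x = f.1 y) : x = y := by
  obtain ⟨s, hs⟩ := hne
  have hi := h.injOn hS hs
  by_cases hy : y ∈ S
  · exact absurd (hi (by simp [hx]) (by simp) (hxy.trans (h y hy s hs))) (fun e => hx (e ▸ hs))
  · exact hi (by simp [hx]) (by simp [hy]) hxy

/-- A section and a cell which is constant on `S` and matches the section. -/
structure Ref {N p : ℕ} (S : Finset (Fin (N + 1))) (ρ : Fin (p + 1) → Fin (N + 1))
    (f : Cell N p) : Prop where
  zero : ρ 0 = 0
  comp : f.1 ∘ ρ = id
  const : ConstOn f S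

lemma exists_ref {N p : ℕ} (S : Finset (Fin (N + 1))) (hne : S.Nonempty)
    (hS : S.card + p = N + 1) : ∃ (ρ : Fin (p + 1) → Fin (N + 1)) (f : Cell N p), Ref S ρ f := by
  set s := S.min' hne with hs
  have hsS : s ∈ S := S.min'_mem hne
  have hcard : (insert s Sᶜ).card = p + 1 := by
    rw [Finset.card_insert_of_notMem (by simpa using hsS), Finset.card_compl, Fintype.card_fin]
    omega
  let e := (insert s Sᶜ).orderIsoOfFin hcard
  have hcol : ∀ x, (if x ∈ S then s else x) ∈ insert s Sᶜ := by
    intro x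
    split_ifs with hx <;> simp [hx]
  let g : Fin (N + 1) → Fin (p + 1) := fun x => e.symm ⟨if x ∈ S then s else x, hcol x⟩
  have hgρ : ∀ i, g (e i) = i := by
    intro i
    have : (⟨if (e i : Fin (N + 1)) ∈ S then s else (e i : Fin (N + 1)), hcol (e i)⟩ :
        {x // x ∈ insert s Sᶜ}) = e i := by
      apply Subtype.ext
      have := (e i).2
      simp only [Finset.mem_insert, Finset.mem_compl] at this
      split_ifs with hc
      · simp only [hc, not_true, or_false] at this
        exact this.symm
      · rfl
    simp only [g, this, OrderIso.symm_apply_apply]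
  have h0 : ((e 0 : {x // x ∈ insert s Sᶜ}) : Fin (N + 1)) = 0 := by
    have hm : (0 : Fin (N + 1)) ∈ insert s Sᶜ := by
      by_cases hx : (0 : Fin (N + 1)) ∈ S
      · have : s = 0 := le_antisymm (S.min'_le 0 hx) (Fin.zero_le _)
        simp [this]
      · simp [hx]
    have h1 : e 0 ≤ ⟨0, hm⟩ := by
      rw [← OrderIso.le_symm_apply]
      exact Fin.zero_le _
    exact le_antisymm h1 (Fin.zero_le _)
  refine ⟨fun i => e i, ⟨g, fun i => ⟨e i, hgρ i⟩, ?_⟩, h0, funext hgρ, ?_⟩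
  · rw [← h0, hgρ]
  · intro x hx y hy
    simp only [g, if_pos hx, if_pos hy]

/-- The section of a reference cell. -/
noncomputable def refSec {N : ℕ} (p : ℕ) (S : Finset (Fin (N + 1))) : Fin (p + 1) → Fin (N + 1) :=
  open Classical in
  if h : S.Nonempty ∧ S.card + p = N + 1 then (exists_ref S h.1 h.2).choose else fun _ => 0

lemma exists_ref_refSec {N p : ℕ} (S : Finset (Fin (N + 1))) (hne : S.Nonempty)
    (hS : S.card + p = N + 1) : ∃ f : Cell N p, Ref S (refSec p S) f := by
  unfold refSec
  rw [dif_pos ⟨hne, hS⟩]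
  exact (exists_ref S hne hS).choose_spec

lemma Ref.exists_eq {N p : ℕ} {S : Finset (Fin (N + 1))} {ρ : Fin (p + 1) → Fin (N + 1)}
    {f : Cell N p} (h : Ref S ρ f) (hne : S.Nonempty) (hS : S.card + p = N + 1)
    {x : Fin (N + 1)} (hx : x ∉ S) : ∃ i, ρ i = x := by
  refine ⟨f.1 x, (h.const.eq_of_notMem hS hne hx ?_).symm⟩
  exact (congrFun h.comp (f.1 x)).symm

lemma Ref.detCochain_eq_zero {N p : ℕ} {S : Finset (Fin (N + 1))} {ρ : Fin (p + 1) → Fin (N + 1)}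
    {f g : Cell N p} (h : Ref S ρ f) (hne : S.Nonempty) (hS : S.card + p = N + 1)
    {x : Fin (N + 1)} (hx : x ∉ S) (hx0 : x ≠ 0) (hg : g.1 x = g.1 0) : detCochain ρ g = 0 := by
  obtain ⟨i, rfl⟩ := h.exists_eq hne hS hx
  refine permDet_of_not_injective (a := i) (b := 0) ?_ ?_
  · rintro rfl
    exact hx0 h.zero
  · simp [h.zero, hg]

/-- The complement of a set of nonzero vertices. -/
def coSet {N p : ℕ} (T : {T : Finset (Fin N) // T.card = p}) : Finset (Fin (N + 1)) :=
  (T.1.map (Fin.succEmb N))ᶜ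

lemma zero_mem_coSet {N p : ℕ} (T : {T : Finset (Fin N) // T.card = p}) : 0 ∈ coSet T := by
  simp [coSet, Fin.succ_ne_zero]

lemma card_coSet {N p : ℕ} (T : {T : Finset (Fin N) // T.card = p}) :
    (coSet T).card + p = N + 1 := by
  have h1 := T.2
  have h2 := Finset.card_le_univ T.1
  rw [Fintype.card_fin] at h2
  rw [coSet, Finset.card_compl, Finset.card_map, Fintype.card_fin]
  omega

lemma mem_coSet_succ {N p : ℕ} (T : {T : Finset (Fin N) // T.card = p}) (x : Fin N) :
    x.succ ∈ coSet T ↔ x ∉ T.1 := by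
  simp [coSet]

/-- The pairing of chains with the cocycles given by reference sections. -/
noncomputable def periods (N p : ℕ) :
    (Cell N p → ℚ) →ₗ[ℚ] ({T : Finset (Fin N) // T.card = p} → ℚ) :=
  LinearMap.pi fun T => Fintype.linearCombination ℚ (detCochain (refSec p (coSet T)))

lemma periods_apply {N p : ℕ} (c : Cell N p → ℚ) (T) :
    periods N p c T = ∑ f, c f * detCochain (refSec p (coSet T)) f := by
  simp [periods, Fintype.linearCombination_apply]

lemma periods_bd {N p : ℕ} (c : Cell N (p + 1) → ℚ) : periods N p (bd N p c) = 0 := by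
  funext T
  obtain ⟨f, hf⟩ := exists_ref_refSec (coSet T) ⟨0, zero_mem_coSet T⟩ (card_coSet T)
  rw [periods_apply, pairing, cobd_detCochain _ hf.zero]
  simp

lemma periods_altChain {N p : ℕ} (T' T : {T : Finset (Fin N) // T.card = p}) (h : T' ≠ T) :
    periods N p (altChain (refSec p (coSet T')) (coSet T')) T = 0 := by
  obtain ⟨f, hf⟩ := exists_ref_refSec (coSet T) ⟨0, zero_mem_coSet T⟩ (card_coSet T)
  have : ∃ x ∈ T.1, x ∉ T'.1 := by
    by_contra hc
    push Not at hc
    exact h (Subtype.ext (Finset.eq_of_subset_of_card_le hc (by rw [T.2, T'.2]))).symm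
  obtain ⟨x, hx, hx'⟩ := this
  rw [periods_apply]
  refine Finset.sum_eq_zero fun g _ => ?_
  by_cases hg : ConstOn g (coSet T')
  · rw [hf.detCochain_eq_zero ⟨0, zero_mem_coSet T⟩ (card_coSet T) (x := x.succ)
      (by simp [mem_coSet_succ, hx]) (Fin.succ_ne_zero x)
      (hg _ ((mem_coSet_succ T' x).2 hx') _ (zero_mem_coSet T')), mul_zero]
  · rw [altChain_of_not_constOn hg, zero_mul]

lemma periods_altChain_self {N p : ℕ} (T : {T : Finset (Fin N) // T.card = p}) :
    periods N p (altChain (refSec p (coSet T)) (coSet T)) T ≠ 0 := by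
  obtain ⟨f, hf⟩ := exists_ref_refSec (coSet T) ⟨0, zero_mem_coSet T⟩ (card_coSet T)
  rw [periods_apply]
  apply ne_of_gt
  refine Finset.sum_pos' (fun g _ => ?_) ⟨f, Finset.mem_univ _, ?_⟩
  · by_cases hg : ConstOn g (coSet T)
    · rw [altChain_of_constOn hg]
      exact mul_self_nonneg _
    · rw [altChain_of_not_constOn hg, zero_mul]
  · rw [altChain_of_constOn hf.const, detCochain, hf.comp, permDet_id]
    norm_num

lemma map_eq_top_of_diagonal {V ι : Type} [AddCommGroup V] [Module ℚ V] [Fintype ι]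
    (L : V →ₗ[ℚ] (ι → ℚ)) (A : Submodule ℚ V) (v : ι → V) (hA : ∀ i, v i ∈ A)
    (h0 : ∀ i j, i ≠ j → L (v i) j = 0) (h1 : ∀ i, L (v i) i ≠ 0) : A.map L = ⊤ := by
  classical
  rw [eq_top_iff]
  intro y _
  rw [← Finset.univ_sum_single y]
  refine Submodule.sum_mem _ fun i _ => ?_
  refine ⟨(y i / L (v i) i) • v i, A.smul_mem _ (hA i), ?_⟩
  rw [map_smul]
  funext j
  by_cases h : i = j
  · subst h
    simp [h1 i]
  · simp [h0 i j h, Pi.single_eq_of_ne (Ne.symm h)]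

lemma finrank_inf_ker_periods {N p : ℕ} (A : Submodule ℚ (Cell N p → ℚ))
    (hA : ∀ T : {T : Finset (Fin N) // T.card = p},
      altChain (refSec p (coSet T)) (coSet T) ∈ A) :
    Module.finrank ℚ A = N.choose p
      + Module.finrank ℚ (A ⊓ LinearMap.ker (periods N p) : Submodule ℚ (Cell N p → ℚ)) := by
  have h := LinearMap.finrank_range_add_finrank_ker ((periods N p).domRestrict A)
  rw [LinearMap.range_domRestrict, map_eq_top_of_diagonal _ A _ hA periods_altChain
      periods_altChain_self, finrank_top, Module.finrank_pi,
    Fintype.card_finset_len, Fintype.card_fin, LinearMap.ker_domRestrict] at h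
  rw [← h, ← Submodule.map_comap_subtype]
  congr 1
  exact ((LinearEquiv.finrank_eq (Submodule.equivMapOfInjective _ A.injective_subtype _)))

lemma range_bd_eq (N M : ℕ) : LinearMap.range (bd N (M + 1)) =
    LinearMap.ker (bd N M) ⊓ LinearMap.ker (periods N (M + 1)) := by
  apply Submodule.eq_of_le_of_finrank_le
  · rintro _ ⟨c, rfl⟩
    exact ⟨bd_bd c, periods_bd c⟩
  · have h1 := finrank_inf_ker_periods (LinearMap.ker (bd N M)) fun T => bd_altChain _ _
    have h2 := card_cell_le N M
    have h3 := LinearMap.finrank_range_add_finrank_ker (bd N M)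
    rw [Module.finrank_pi] at h3
    omega

lemma finrank_ker_bd (N M : ℕ) : Module.finrank ℚ (LinearMap.ker (bd N M)) =
    N.choose (M + 1) + Module.finrank ℚ (LinearMap.range (bd N (M + 1))) := by
  rw [range_bd_eq]
  exact finrank_inf_ker_periods (LinearMap.ker (bd N M)) fun T => bd_altChain _ _

/-! ### Chains supported on cells with a large block -/

lemma eq_zero_of_unique_face {N M : ℕ} {c : Cell N (M + 1) → ℚ} (hc : bd N M c = 0)
    (f : Cell N (M + 1)) {j : ℕ} (hj : j < M + 2)
    (h : ∀ j' < M + 2, ∀ f', c f' ≠ 0 → face j' f' = face j f → j' = j ∧ f' = f) : c f = 0 := by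
  have h1 := congrFun hc (face j f)
  rw [bd_apply', Finset.sum_eq_single j, Finset.sum_eq_single f] at h1
  · simpa using h1
  · intro f' _ hf'
    split_ifs with he
    · by_contra hcf
      exact hf' (h j hj f' hcf he).2
    · rfl
  · simp
  · intro j' hj' hne
    rw [Finset.mem_range] at hj'
    rw [Finset.sum_eq_zero, mul_zero]
    intro f' _
    split_ifs with he
    · by_contra hcf
      exact hne (h j' hj' f' hcf he).1
    · rfl
  · simp [hj]

/-- Chains supported on cells having a block with at least `k` vertices. -/
def bigChains (N p k : ℕ) : Submodule ℚ (Cell N p → ℚ) where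
  carrier := {c | ∀ f, c f ≠ 0 → ∃ S : Finset (Fin (N + 1)), S.card = k ∧ ConstOn f S}
  add_mem' := by
    intro a b ha hb f hf
    by_cases h : a f = 0
    · exact hb f fun hbf => hf (by simp [h, hbf])
    · exact ha f h
  zero_mem' := by simp
  smul_mem' := by
    intro r a ha f hf
    exact ha f fun haf => hf (by simp [haf])

lemma altChain_mem_bigChains {N p k : ℕ} (ρ : Fin (p + 1) → Fin (N + 1))
    (S : Finset (Fin (N + 1))) (hS : S.card = k) : altChain ρ S ∈ bigChains N p k := by
  intro f hf
  refine ⟨S, hS, ?_⟩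
  by_contra h
  exact hf (altChain_of_not_constOn h)

lemma face_eq_imp {N M j : ℕ} {f : Cell N (M + 1)} {x y : Fin (N + 1)}
    (h : (face j f).1 x = (face j f).1 y) (hxy : f.1 x ≠ f.1 y) :
    (j ≤ M ∧ ((f.1 x : ℕ) = j ∧ (f.1 y : ℕ) = j + 1 ∨ (f.1 x : ℕ) = j + 1 ∧ (f.1 y : ℕ) = j)) ∨
    (M < j ∧ ((f.1 x : ℕ) = 0 ∧ (f.1 y : ℕ) = M + 1 ∨ (f.1 x : ℕ) = M + 1 ∧ (f.1 y : ℕ) = 0)) := by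
  rw [Fin.ext_iff, face_val, face_val] at h
  rw [Ne, Fin.ext_iff] at hxy
  have := (f.1 x).isLt
  have := (f.1 y).isLt
  split_ifs at h <;> omega

/-- If two singleton blocks are merged, the large block is still visible. -/
lemma constOn_of_face_eq {N M k j j' : ℕ} (hk : 3 ≤ k) {f f' : Cell N (M + 1)}
    {S S' : Finset (Fin (N + 1))} (hS : S.card = k) (hS' : S'.card = k)
    (hkN : k + (M + 1) = N + 1) (hf : ConstOn f S) (hf' : ConstOn f' S') {a b : Fin (N + 1)}
    (ha : a ∉ S) (hb : b ∉ S) (hab : a ≠ b) (hfab : (face j f).1 a = (face j f).1 b)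
    (he : face j' f' = face j f) : S' = S := by
  have hc : S.card + (M + 1) = N + 1 := by omega
  have hne : S.Nonempty := Finset.card_pos.1 (by omega)
  have hn : f.1 a ≠ f.1 b := fun h => hab (hf.eq_of_notMem hc hne ha h)
  refine Finset.eq_of_subset_of_card_le ?_ (by omega)
  intro x hx
  by_contra hxS
  have key : S' ⊆ {x, a, b} ∧ (x ≠ a → x ≠ b → S' ⊆ {x}) := by
    have h1 : ∀ y ∈ S', y = x ∨ (x = a ∧ y = b) ∨ (x = b ∧ y = a) := by
      intro y hy
      by_cases hxy : f.1 x = f.1 y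
      · exact Or.inl (hf.eq_of_notMem hc hne hxS hxy).symm
      · right
        have hg : (face j f).1 x = (face j f).1 y := by
          rw [← he]
          apply Fin.ext
          rw [face_val, face_val, hf' x hx y hy]
        have h2 := face_eq_imp hg hxy
        have h3 := face_eq_imp hfab hn
        have hxa : f.1 a = f.1 x → a = x := fun h => hf.eq_of_notMem hc hne ha h
        have hxb : f.1 b = f.1 x → b = x := fun h => hf.eq_of_notMem hc hne hb h
        have hya : f.1 a = f.1 y → a = y := fun h => hf.eq_of_notMem hc hne ha h
        have hyb : f.1 b = f.1 y → b = y := fun h => hf.eq_of_notMem hc hne hb h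
        simp only [Fin.ext_iff (a := f.1 _)] at hxa hxb hya hyb
        by_cases hq : (f.1 a : ℕ) = f.1 x
        · exact Or.inl ⟨(hxa hq).symm, (hyb (by omega)).symm⟩
        · exact Or.inr ⟨(hxb (by omega)).symm, (hya (by omega)).symm⟩
    constructor
    · intro y hy
      have := h1 y hy
      simp only [Finset.mem_insert, Finset.mem_singleton]
      tauto
    · intro hxa hxb y hy
      have := h1 y hy
      simp only [Finset.mem_singleton]
      tauto
  by_cases hx' : x = a ∨ x = b
  · have : S' ⊆ {a, b} := fun y hy => by
      have := key.1 hy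
      simp only [Finset.mem_insert, Finset.mem_singleton] at this ⊢
      rcases hx' with rfl | rfl <;> tauto
    have := (Finset.card_le_card this).trans Finset.card_le_two
    omega
  · push Not at hx'
    have := Finset.card_le_card (key.2 hx'.1 hx'.2)
    simp at this
    omega

/-- Two adjacent singleton blocks may be exchanged. -/
lemma eq_zero_of_swap {N M k j : ℕ} (hk : 3 ≤ k) (hkN : k + (M + 1) = N + 1)
    {c : Cell N (M + 1) → ℚ} (hc : bd N M c = 0) (hW : c ∈ bigChains N (M + 1) k)
    {f : Cell N (M + 1)} {S : Finset (Fin (N + 1))} (hS : S.card = k) (hf : ConstOn f S)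
    {a b : Fin (N + 1)} (ha : a ∉ S) (hb : b ∉ S) (h0 : 0 < j) (hj : j < M + 1)
    (hfa : (f.1 a : ℕ) = j) (hfb : (f.1 b : ℕ) = j + 1)
    (hz : c (recolor (adjSwap M hj) (adjSwap_zero hj h0) f) = 0) : c f = 0 := by
  have hab : a ≠ b := by rintro rfl; omega
  have hcS : S.card + (M + 1) = N + 1 := by omega
  have hne : S.Nonempty := Finset.card_pos.1 (by omega)
  have hga : ((face j f).1 a : ℕ) = j := by
    rw [face_val]
    split_ifs <;> omega
  have hgb : ((face j f).1 b : ℕ) = j := by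
    rw [face_val]
    split_ifs <;> omega
  refine eq_zero_of_unique_face hc f (j := j) (by omega) fun j' hj' f' hcf' he => ?_
  obtain ⟨S', hS', hf'⟩ := hW f' hcf'
  obtain rfl := constOn_of_face_eq hk hS hS' hkN hf hf' ha hb hab (Fin.ext (hga.trans hgb.symm)) he
  have hn : f'.1 a ≠ f'.1 b := fun h => hab (hf'.eq_of_notMem hcS hne ha h)
  have h1 := face_eq_imp (j := j') (f := f') (x := a) (y := b)
    (by rw [he]; exact Fin.ext (hga.trans hgb.symm)) hn
  have hg'a : ((face j' f').1 a : ℕ) = j := by rw [he]; exact hga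
  rw [face_val] at hg'a
  obtain rfl : j' = j := by split_ifs at hg'a <;> omega
  refine ⟨rfl, ?_⟩
  have hrest : ∀ x, x ≠ a → x ≠ b → (f'.1 x : ℕ) = f.1 x := by
    intro x hxa hxb
    have e1 : (f'.1 a : ℕ) ≠ f'.1 x := fun h => hxa (hf'.eq_of_notMem hcS hne ha (Fin.ext h)).symm
    have e2 : (f'.1 b : ℕ) ≠ f'.1 x := fun h => hxb (hf'.eq_of_notMem hcS hne hb (Fin.ext h)).symm
    have e3 : (f.1 a : ℕ) ≠ f.1 x := fun h => hxa (hf.eq_of_notMem hcS hne ha (Fin.ext h)).symm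
    have e4 : (f.1 b : ℕ) ≠ f.1 x := fun h => hxb (hf.eq_of_notMem hcS hne hb (Fin.ext h)).symm
    have e5 : ((face j' f').1 x : ℕ) = (face j' f).1 x := by rw [he]
    rw [face_val, face_val] at e5
    split_ifs at e5 <;> omega
  by_cases hq : (f'.1 a : ℕ) = j'
  · apply cell_ext
    intro x
    by_cases hxa : x = a
    · subst hxa; omega
    by_cases hxb : x = b
    · subst hxb; omega
    exact hrest x hxa hxb
  · refine absurd hz ?_
    convert hcf'
    apply cell_ext
    intro x
    rw [recolor_val, adjSwap_val]
    by_cases hxa : x = a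
    · subst hxa; split_ifs <;> omega
    by_cases hxb : x = b
    · subst hxb; split_ifs <;> omega
    have e3 : (f.1 a : ℕ) ≠ f.1 x := fun h => hxa (hf.eq_of_notMem hcS hne ha (Fin.ext h)).symm
    have e4 : (f.1 b : ℕ) ≠ f.1 x := fun h => hxb (hf.eq_of_notMem hcS hne hb (Fin.ext h)).symm
    rw [hrest x hxa hxb]
    split_ifs <;> omega

lemma rot_symm_zero (M : ℕ) : (rot M).symm 0 = 0 := by
  rw [Equiv.symm_apply_eq, rot_zero]

lemma rot_symm_val (M : ℕ) (x : Fin (M + 2)) : ((rot M).symm x : ℕ) =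
    if (x : ℕ) = 0 then (0 : ℕ) else if (x : ℕ) = 1 then M + 1 else (x : ℕ) - 1 := by
  obtain ⟨y, rfl⟩ := (rot M).surjective x
  have := y.isLt
  have h := rot_val M y
  rw [Equiv.symm_apply_apply]
  split_ifs at h ⊢ <;> omega

/-- If the first two blocks are singletons, the second one may be moved to the end. -/
lemma eq_zero_of_rot {N M k : ℕ} (hk : 3 ≤ k) (hkN : k + (M + 1) = N + 1)
    {c : Cell N (M + 1) → ℚ} (hc : bd N M c = 0) (hW : c ∈ bigChains N (M + 1) k)
    {f : Cell N (M + 1)} {S : Finset (Fin (N + 1))} (hS : S.card = k) (hf : ConstOn f S)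
    {a : Fin (N + 1)} (ha : a ∉ S) (h0 : 0 ∉ S) (hfa : (f.1 a : ℕ) = 1) (hM : 0 < M)
    (hz : c (recolor (rot M).symm (rot_symm_zero M) f) = 0) : c f = 0 := by
  have hf0 := cell_zero f
  have hab : a ≠ 0 := by rintro rfl; omega
  have hcS : S.card + (M + 1) = N + 1 := by omega
  have hne : S.Nonempty := Finset.card_pos.1 (by omega)
  have hga : ((face 0 f).1 a : ℕ) = 0 := by
    rw [face_val]
    split_ifs <;> omega
  have hgb : ((face 0 f).1 0 : ℕ) = 0 := cell_zero _
  refine eq_zero_of_unique_face hc f (j := 0) (by omega) fun j' hj' f' hcf' he => ?_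
  obtain ⟨S', hS', hf'⟩ := hW f' hcf'
  obtain rfl := constOn_of_face_eq hk hS hS' hkN hf hf' ha h0 hab (Fin.ext (hga.trans hgb.symm)) he
  have hn : f'.1 a ≠ f'.1 0 := fun h => hab (hf'.eq_of_notMem hcS hne ha h)
  have h1 := face_eq_imp (j := j') (f := f') (x := a) (y := 0)
    (by rw [he]; exact Fin.ext (hga.trans hgb.symm)) hn
  have hf'0 := cell_zero f'
  have hrest : ∀ x, x ≠ a → x ≠ 0 → ((face j' f').1 x : ℕ) = (face 0 f).1 x ∧
      (f'.1 a : ℕ) ≠ f'.1 x ∧ (f'.1 x : ℕ) ≠ 0 ∧ (f.1 a : ℕ) ≠ f.1 x ∧ (f.1 x : ℕ) ≠ 0 := by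
    intro x hxa hxb
    refine ⟨by rw [he],
      fun h => hxa (hf'.eq_of_notMem hcS hne ha (Fin.ext h)).symm,
      fun h => hxb (hf'.eq_of_notMem hcS hne h0 (Fin.ext (hf'0.trans h.symm))).symm,
      fun h => hxa (hf.eq_of_notMem hcS hne ha (Fin.ext h)).symm,
      fun h => hxb (hf.eq_of_notMem hcS hne h0 (Fin.ext (hf0.trans h.symm))).symm⟩
  by_cases hq : j' = 0
  · subst hq
    refine ⟨rfl, ?_⟩
    apply cell_ext
    intro x
    by_cases hxa : x = a
    · subst hxa; omega
    by_cases hxb : x = 0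
    · subst hxb; omega
    obtain ⟨e1, e2, e3, e4, e5⟩ := hrest x hxa hxb
    rw [face_val, face_val] at e1
    split_ifs at e1 <;> omega
  · refine absurd hz ?_
    convert hcf'
    apply cell_ext
    intro x
    rw [recolor_val, rot_symm_val]
    by_cases hxa : x = a
    · subst hxa; split_ifs <;> omega
    by_cases hxb : x = 0
    · subst hxb; split_ifs <;> omega
    obtain ⟨e1, e2, e3, e4, e5⟩ := hrest x hxa hxb
    rw [face_val, face_val] at e1
    have := (f'.1 x).isLt
    split_ifs at e1 ⊢ <;> omega

/-- Representatives of the orbits of cells with a large block `S`. -/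
def SortedOff {N p : ℕ} (f : Cell N p) (S : Finset (Fin (N + 1))) : Prop :=
  ConstOn f S ∧ (∀ x ∈ S, (f.1 x : ℕ) ≤ 1) ∧ StrictMonoOn f.1 {x | x ∉ S}

lemma SortedOff.eq {N p : ℕ} {f g : Cell N p} {S : Finset (Fin (N + 1))} (hne : S.Nonempty)
    (hS : S.card + p = N + 1) (hf : SortedOff f S) (hg : SortedOff g S) : f = g := by
  have hval : ∀ f : Cell N p, SortedOff f S → ∀ x ∈ S, (f.1 x : ℕ) = if 0 ∈ S then 0 else 1 := by
    intro f hf x hx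
    split_ifs with h0
    · rw [hf.1 x hx 0 h0, cell_zero]
    · have h1 := hf.2.1 x hx
      have h2 : (f.1 x : ℕ) ≠ 0 := fun h => by
        have := hf.1.eq_of_notMem hS hne h0 (Fin.ext ((cell_zero f).trans h.symm))
        exact h0 (this ▸ hx)
      omega
  have himg : ∀ f : Cell N p, SortedOff f S →
      f.1 '' {x | x ∉ S} = {i : Fin (p + 1) | (i : ℕ) ≠ if 0 ∈ S then 0 else 1} := by
    intro f hf
    ext i
    constructor
    · rintro ⟨x, hx, rfl⟩ h
      obtain ⟨s, hs⟩ := hne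
      have := hf.1.eq_of_notMem hS ⟨s, hs⟩ hx (Fin.ext (h.trans (hval f hf s hs).symm))
      exact hx (this ▸ hs)
    · intro hi
      obtain ⟨x, rfl⟩ := f.2.1 i
      exact ⟨x, fun hx => hi (hval f hf x hx), rfl⟩
  apply cell_ext
  intro x
  by_cases hx : x ∈ S
  · rw [hval f hf x hx, hval g hg x hx]
  · exact congrArg Fin.val
      (eqOn_of_strictMonoOn hf.2.2 hg.2.2 ((himg f hf).trans (himg g hg).symm) hx)

lemma exists_adjacent_inversion {N M : ℕ} {f : Cell N (M + 1)} {S : Finset (Fin (N + 1))}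
    (hne : S.Nonempty) (hS : S.card + (M + 1) = N + 1) (hf : ConstOn f S)
    (h1 : ∀ x ∈ S, (f.1 x : ℕ) ≤ 1) (hn : ¬ SortedOff f S) :
    ∃ a b : Fin (N + 1), a ∉ S ∧ b ∉ S ∧ b < a ∧ 0 < (f.1 a : ℕ) ∧ (f.1 b : ℕ) = f.1 a + 1 := by
  obtain ⟨s, hs⟩ := hne
  by_contra hc
  push Not at hc
  have hSval : ∀ x, x ∉ S → (f.1 x : ℕ) ≠ f.1 s := fun x hx h =>
    hx (hf.eq_of_notMem hS ⟨s, hs⟩ hx (Fin.ext h) ▸ hs)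
  have key : ∀ d x y, x ∉ S → y ∉ S → (f.1 s : ℕ) < f.1 y → (f.1 x : ℕ) = f.1 y + d + 1 →
      y < x := by
    intro d
    induction d with
    | zero =>
      intro x y hx hy hsy hxy
      by_contra hlt
      have hne : x ≠ y := by rintro rfl; omega
      exact hc y x hy hx (lt_of_le_of_ne (not_lt.1 hlt) hne) (by omega) (by omega)
    | succ d ih =>
      intro x y hx hy hsy hxy
      have := (f.1 x).isLt
      obtain ⟨z, hz⟩ := exists_val_eq f (i := f.1 y + d + 1) (by omega)
      have hzS : z ∉ S := fun h => by
        have := hf z h s hs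
        rw [this] at hz
        omega
      refine (ih z y hzS hy hsy hz).trans ?_
      by_contra hlt
      have hne : x ≠ z := by rintro rfl; omega
      exact hc z x hzS hx (lt_of_le_of_ne (not_lt.1 hlt) hne) (by omega) (by omega)
  refine hn ⟨hf, h1, ?_⟩
  intro x hx y hy hxy
  by_contra hlt
  rw [not_lt, Fin.le_def] at hlt
  have hne : (f.1 y : ℕ) ≠ f.1 x := fun h =>
    hxy.ne' (hf.eq_of_notMem hS ⟨s, hs⟩ hy (Fin.ext h))
  have hsy : (f.1 s : ℕ) < f.1 y := by
    have h2 := h1 s hs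
    have h3 := hSval y hy
    have h4 : (f.1 y : ℕ) ≠ 0 := fun h => by
      have := hf.eq_of_notMem hS ⟨s, hs⟩ hy (Fin.ext (h.trans (cell_zero f).symm))
      rw [this] at hxy
      exact absurd hxy (Fin.not_lt_zero x)
    omega
  exact absurd (key (f.1 x - f.1 y - 1) x y hx hy hsy (by omega)) (not_lt.2 hxy.le)

lemma eq_zero_of_sortedOff {N M k : ℕ} (hk : 3 ≤ k) (hkN : k + (M + 1) = N + 1)
    {c : Cell N (M + 1) → ℚ} (hc : bd N M c = 0) (hW : c ∈ bigChains N (M + 1) k)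
    (h0 : ∀ f S, S.card = k → SortedOff f S → c f = 0) : c = 0 := by
  have key : ∀ s t : ℕ, ∀ f S, S.card = k → ConstOn f S → (∀ x ∈ S, (f.1 x : ℕ) = s) →
      (N + 1) * ((N + 1) * (M + 2)) - ∑ x : Fin (N + 1), (x : ℕ) * (f.1 x : ℕ) = t → c f = 0 := by
    intro s
    induction s using Nat.strong_induction_on with
    | _ s ihs =>
    intro t
    induction t using Nat.strong_induction_on with
    | _ t iht =>
    intro f S hS hf hs ht
    have hcS : S.card + (M + 1) = N + 1 := by omega
    have hne : S.Nonempty := Finset.card_pos.1 (by omega)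
    by_cases h1 : s ≤ 1
    · by_cases hsort : SortedOff f S
      · exact h0 f S hS hsort
      obtain ⟨a, b, ha, hb, hba, hfa, hfb⟩ :=
        exists_adjacent_inversion hne hcS hf (fun x hx => (hs x hx).trans_le h1) hsort
      have hj : (f.1 a : ℕ) < M + 1 := by
        have := (f.1 b).isLt
        omega
      refine eq_zero_of_swap hk hkN hc hW hS hf ha hb hfa hj rfl hfb ?_
      have hval : ∀ x, ((recolor (adjSwap M hj) (adjSwap_zero hj hfa) f).1 x : ℕ) =
          if x = a then (f.1 a : ℕ) + 1 else if x = b then (f.1 a : ℕ) else f.1 x := by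
        intro x
        have e3 : x ≠ a → (f.1 x : ℕ) ≠ f.1 a := fun hx h =>
          hx (hf.eq_of_notMem hcS hne ha (Fin.ext h.symm)).symm
        have e4 : x ≠ b → (f.1 x : ℕ) ≠ f.1 b := fun hx h =>
          hx (hf.eq_of_notMem hcS hne hb (Fin.ext h.symm)).symm
        rw [recolor_val, adjSwap_val]
        by_cases hxa : x = a
        · rw [if_pos (by rw [hxa]), if_pos hxa]
        · rw [if_neg (e3 hxa), if_neg hxa]
          by_cases hxb : x = b
          · rw [if_pos (by rw [hxb, hfb]), if_pos hxb]
          · rw [if_neg (by rw [← hfb]; exact e4 hxb), if_neg hxb]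
      have hbound : ∀ g : Cell N (M + 1),
          ∑ x : Fin (N + 1), (x : ℕ) * (g.1 x : ℕ) ≤ (N + 1) * ((N + 1) * (M + 2)) := by
        intro g
        refine (Finset.sum_le_card_nsmul Finset.univ _ ((N + 1) * (M + 2)) fun x _ =>
          Nat.mul_le_mul x.isLt.le (g.1 x).isLt.le).trans ?_
        simp
      have hsum : ∑ x : Fin (N + 1), (x : ℕ) * ((recolor (adjSwap M hj) (adjSwap_zero hj hfa) f).1 x : ℕ)
          + b = ∑ x : Fin (N + 1), (x : ℕ) * (f.1 x : ℕ) + a := by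
        have e1 : ((b : Fin (N + 1)) : ℕ) = ∑ x : Fin (N + 1), if x = b then (x : ℕ) else 0 := by
          simp
        have e2 : ((a : Fin (N + 1)) : ℕ) = ∑ x : Fin (N + 1), if x = a then (x : ℕ) else 0 := by
          simp
        rw [e1, e2, ← Finset.sum_add_distrib, ← Finset.sum_add_distrib]
        refine Finset.sum_congr rfl fun x _ => ?_
        rw [hval]
        by_cases hxa : x = a
        · subst hxa
          rw [if_pos rfl, if_neg hba.ne', if_pos rfl]
          ring
        · by_cases hxb : x = b
          · subst hxb
            rw [if_neg hxa, if_pos rfl, if_pos rfl, if_neg hxa, hfb]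
            ring
          · simp [hxa, hxb]
      have hlt : (b : ℕ) < a := hba
      refine iht _ ?_ _ S hS ?_ ?_ rfl
      · have := hbound (recolor (adjSwap M hj) (adjSwap_zero hj hfa) f)
        omega
      · intro x hx y hy
        rw [recolor_val, recolor_val, hf x hx y hy]
      · intro x hx
        rw [hval, if_neg (by rintro rfl; exact ha hx), if_neg (by rintro rfl; exact hb hx),
          hs x hx]
    · have h0S : 0 ∉ S := fun h => by
        have := hs 0 h
        rw [cell_zero] at this
        omega
      obtain ⟨x, hx⟩ := id hne
      have hsM : s < M + 2 := hs x hx ▸ (f.1 x).isLt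
      obtain ⟨a, ha⟩ := exists_val_eq f (i := 1) (by omega)
      have haS : a ∉ S := fun h => by
        have := hs a h
        omega
      refine eq_zero_of_rot hk hkN hc hW hS hf haS h0S ha (by omega) ?_
      refine ihs (s - 1) (by omega) _ _ S hS ?_ ?_ rfl
      · intro x hx y hy
        rw [recolor_val, recolor_val, hf x hx y hy]
      · intro x hx
        rw [recolor_val, rot_symm_val, hs x hx, if_neg (by omega), if_neg (by omega)]
  funext f
  by_contra hcf
  obtain ⟨S, hS, hf⟩ := hW f hcf
  obtain ⟨s, hs⟩ := Finset.card_pos.1 (show 0 < S.card by omega)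
  exact hcf (key (f.1 s) _ f S hS hf (fun x hx => by rw [hf x hx s hs]) rfl)

lemma finrank_bigCycles {N M k : ℕ} (hk : 3 ≤ k) (hkN : k + (M + 1) = N + 1) :
    Module.finrank ℚ (LinearMap.ker (bd N M) ⊓ bigChains N (M + 1) k :
      Submodule ℚ (Cell N (M + 1) → ℚ)) = (N + 1).choose k := by
  classical
  set A := LinearMap.ker (bd N M) ⊓ bigChains N (M + 1) k with hA
  have hι : Fintype.card {S : Finset (Fin (N + 1)) // S.card = k} = (N + 1).choose k := by
    rw [Fintype.card_finset_len, Fintype.card_fin]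
  have hne : ∀ S : {S : Finset (Fin (N + 1)) // S.card = k}, S.1.Nonempty := fun S =>
    Finset.card_pos.1 (by have := S.2; omega)
  have hcS : ∀ S : {S : Finset (Fin (N + 1)) // S.card = k}, S.1.card + (M + 1) = N + 1 :=
    fun S => by have := S.2; omega
  rw [← hι]
  apply le_antisymm
  · let R : A →ₗ[ℚ] ({f : Cell N (M + 1) // ∃ S, S.card = k ∧ SortedOff f S} → ℚ) :=
      (LinearMap.funLeft ℚ ℚ Subtype.val) ∘ₗ A.subtype
    have hR : Injective R := by
      rw [← LinearMap.ker_eq_bot, LinearMap.ker_eq_bot']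
      intro c hc
      apply Subtype.ext
      refine eq_zero_of_sortedOff hk hkN c.2.1 c.2.2 fun f S hS hf => ?_
      exact congrFun hc ⟨f, S, hS, hf⟩
    refine (LinearMap.finrank_le_finrank_of_injective hR).trans ?_
    rw [Module.finrank_pi]
    choose S hS hf using fun f : {f : Cell N (M + 1) // ∃ S, S.card = k ∧ SortedOff f S} => f.2
    refine Fintype.card_le_of_injective (fun f => ⟨S f, hS f⟩) fun f g hfg => ?_
    have hfg' : S f = S g := congrArg Subtype.val hfg
    apply Subtype.ext
    refine SortedOff.eq (hne ⟨S f, hS f⟩) (hcS ⟨S f, hS f⟩) (hf f) ?_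
    have := hf g
    rwa [← hfg'] at this
  · choose r hr using fun S : {S : Finset (Fin (N + 1)) // S.card = k} =>
      exists_ref_refSec (p := M + 1) S.1 (hne S) (hcS S)
    have htop := map_eq_top_of_diagonal (LinearMap.funLeft ℚ ℚ r) A
      (fun S => altChain (refSec (M + 1) S.1) S.1)
      (fun S => ⟨bd_altChain _ _, altChain_mem_bigChains _ _ S.2⟩) ?_ ?_
    · rw [← Module.finrank_pi ℚ, ← finrank_top ℚ, ← htop]
      exact Submodule.finrank_map_le _ _
    · intro S S' hSS'
      refine altChain_of_not_constOn fun h => hSS' (Subtype.ext ?_)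
      refine Finset.eq_of_subset_of_card_le (fun x hx => ?_) (by rw [S.2, S'.2])
      by_contra hxS'
      obtain ⟨y, hy, hyx⟩ := Finset.exists_mem_ne (by rw [S.2]; omega) x
      exact hyx ((hr S').const.eq_of_notMem (hcS S') (hne S') hxS' (h x hx y hy)).symm
    · intro S
      rw [LinearMap.funLeft_apply, altChain_of_constOn (hr S).const, detCochain, (hr S).comp,
        permDet_id]
      exact one_ne_zero

lemma finrank_range_bd_inf_bigChains {N M k : ℕ} (hk : 3 ≤ k) (hkN : k + (M + 1) = N + 1) :
    Module.finrank ℚ (LinearMap.range (bd N (M + 1)) ⊓ bigChains N (M + 1) k :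
      Submodule ℚ (Cell N (M + 1) → ℚ)) = N.choose M := by
  have h1 := finrank_inf_ker_periods (LinearMap.ker (bd N M) ⊓ bigChains N (M + 1) k)
    fun T => ⟨bd_altChain _ _, altChain_mem_bigChains _ _ (by have := card_coSet T; omega)⟩
  rw [finrank_bigCycles hk hkN, inf_right_comm, ← range_bd_eq,
    Nat.choose_symm_of_eq_add (n := N + 1) (a := k) (b := M + 1) (by omega),
    Nat.choose_succ_succ'] at h1
  omega

/-! ### Comparison with the complex of a hyperedge condition -/

section Transfer

variable {N : ℕ} {P : (m : ℕ) → (Fin (N + 1) → Fin m) → Prop}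

/-- The cell underlying a basis element of the complex with hyperedge condition. -/
def toCell {M : ℕ} (f : CycBas (N + 1) P (M + 1)) : Cell N M :=
  ⟨f.1, f.2.1, Fin.ext (f.2.2.1 0 rfl)⟩

lemma toCell_injective {M : ℕ} : Injective (toCell : CycBas (N + 1) P (M + 1) → Cell N M) :=
  fun f g h => Subtype.ext (show (toCell f).1 = (toCell g).1 by rw [h])

lemma toCell_surjective {M : ℕ} (hP : ∀ f : Fin (N + 1) → Fin (M + 1), Surjective f → P (M + 1) f) :
    Surjective (toCell : CycBas (N + 1) P (M + 1) → Cell N M) := fun f =>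
  ⟨⟨f.1, f.2.1, fun x hx => by
    obtain rfl : x = 0 := Fin.ext hx
    exact cell_zero f, hP f.1 f.2.1⟩, rfl⟩

lemma cycMat_eq_incidence {M : ℕ} (f : CycBas (N + 1) P (M + 2)) (g : CycBas (N + 1) P (M + 1)) :
    cycMat (N + 1) P (M + 1) f g = incidence N M (toCell f) (toCell g) := by
  unfold cycMat incidence
  rw [Finset.sum_range_succ, Finset.sum_range]
  congr 1
  · refine Finset.sum_congr rfl fun j _ => ?_
    congr 1
    refine if_congr ?_ rfl rfl
    have hj := j.isLt
    have hv : ∀ x, ((mergeMap j ∘ f.1) x : ℕ) = (face (j : ℕ) (toCell f)).1 x := by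
      intro x
      have hx : (toCell f).1 x = f.1 x := rfl
      rw [face_val, if_pos (by omega), hx, comp_apply, mergeMap]
      split_ifs <;> rfl
    constructor
    · intro h
      apply cell_ext
      intro x
      rw [← hv, h]
      rfl
    · intro h
      funext x
      apply Fin.ext
      rw [hv, h]
      rfl
  · congr 1
    refine if_congr ?_ rfl rfl
    have hx : ∀ x, (toCell f).1 x = f.1 x := fun _ => rfl
    have hx' : ∀ x, (toCell g).1 x = g.1 x := fun _ => rfl
    constructor
    · intro h
      apply cell_ext
      intro y
      rw [face_val, if_neg (by omega), hx, hx']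
      split_ifs with hy
      · exact ((h y).1 hy).symm
      · exact ((h y).2 hy).symm
    · intro h y
      rw [← hx', ← h, face_val, if_neg (by omega), hx]
      constructor <;> intro hy
      · rw [if_pos hy]
      · rw [if_neg hy]

lemma cycBnd_funLeft {M : ℕ}
    (hP : ∀ f : Fin (N + 1) → Fin (M + 2), Surjective f → P (M + 2) f) (c : Cell N (M + 1) → ℚ) :
    cycBnd (N + 1) P (M + 1) (LinearMap.funLeft ℚ ℚ toCell c)
      = LinearMap.funLeft ℚ ℚ toCell (bd N M c) := by
  funext g
  rw [LinearMap.funLeft_apply, bd_apply,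
    ← (Bijective.sum_comp ⟨toCell_injective, toCell_surjective hP⟩ _)]
  exact Finset.sum_congr rfl fun f _ => congrArg _ (cycMat_eq_incidence f g)

lemma finrank_ker_comp {U V W : Type} [AddCommGroup U] [AddCommGroup V] [AddCommGroup W]
    [Module ℚ U] [Module ℚ V] [Module ℚ W] [FiniteDimensional ℚ U] (d : U →ₗ[ℚ] V)
    (π : V →ₗ[ℚ] W) : Module.finrank ℚ (LinearMap.ker (π ∘ₗ d)) = Module.finrank ℚ (LinearMap.ker d)
      + Module.finrank ℚ (LinearMap.range d ⊓ LinearMap.ker π : Submodule ℚ V) := by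
  have h := LinearMap.finrank_range_add_finrank_ker (d.domRestrict (LinearMap.ker (π ∘ₗ d)))
  rw [LinearMap.range_domRestrict, LinearMap.ker_comp, Submodule.map_comap_eq,
    LinearMap.ker_domRestrict, (Submodule.comapSubtypeEquivOfLe _).finrank_eq] at h
  · rw [LinearMap.ker_comp, ← h, add_comm]
  · intro x hx
    rw [Submodule.mem_comap, LinearMap.mem_ker.1 hx]
    exact zero_mem _

lemma finrank_homologyOf {A B C : Type} [AddCommGroup A] [AddCommGroup B] [AddCommGroup C]
    [Module ℚ A] [Module ℚ B] [Module ℚ C] [FiniteDimensional ℚ B] {d2 : A →ₗ[ℚ] B}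
    {d1 : B →ₗ[ℚ] C} (h : LinearMap.range d2 ≤ LinearMap.ker d1) :
    Module.finrank ℚ (homologyOf d2 d1) + Module.finrank ℚ (LinearMap.range d2)
      = Module.finrank ℚ (LinearMap.ker d1) := by
  rw [← (Submodule.comapSubtypeEquivOfLe h).finrank_eq]
  exact Submodule.finrank_quotient_add_finrank _

lemma finrank_homology {M : ℕ}
    (h3 : ∀ f : Fin (N + 1) → Fin (M + 3), Surjective f → P (M + 3) f)
    (h2 : ∀ f : Fin (N + 1) → Fin (M + 2), Surjective f → P (M + 2) f)
    (W : Submodule ℚ (Cell N M → ℚ))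
    (hW : ∀ c, c ∈ W ↔ ∀ g : CycBas (N + 1) P (M + 1), c (toCell g) = 0) :
    Module.finrank ℚ (homologyOf (cycBnd (N + 1) P (M + 2)) (cycBnd (N + 1) P (M + 1))) =
      N.choose (M + 1)
        + Module.finrank ℚ (LinearMap.range (bd N M) ⊓ W : Submodule ℚ (Cell N M → ℚ)) := by
  let L2 : (Cell N (M + 1) → ℚ) ≃ₗ[ℚ] (CycBas (N + 1) P (M + 2) → ℚ) :=
    LinearEquiv.funCongrLeft ℚ ℚ (Equiv.ofBijective _ ⟨toCell_injective, toCell_surjective h2⟩)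
  let L3 : (Cell N (M + 2) → ℚ) ≃ₗ[ℚ] (CycBas (N + 1) P (M + 3) → ℚ) :=
    LinearEquiv.funCongrLeft ℚ ℚ (Equiv.ofBijective _ ⟨toCell_injective, toCell_surjective h3⟩)
  let π : (Cell N M → ℚ) →ₗ[ℚ] (CycBas (N + 1) P (M + 1) → ℚ) := LinearMap.funLeft ℚ ℚ toCell
  have e2 : cycBnd (N + 1) P (M + 2) ∘ₗ L3.toLinearMap = L2.toLinearMap ∘ₗ bd N (M + 1) :=
    LinearMap.ext fun c => cycBnd_funLeft h3 c
  have e1 : cycBnd (N + 1) P (M + 1) ∘ₗ L2.toLinearMap = π ∘ₗ bd N M :=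
    LinearMap.ext fun c => cycBnd_funLeft h2 c
  have hπ : LinearMap.ker π = W := by
    ext c
    rw [hW, LinearMap.mem_ker, funext_iff]
    rfl
  have hr : LinearMap.range (cycBnd (N + 1) P (M + 2))
      = (LinearMap.range (bd N (M + 1))).map L2.toLinearMap := by
    rw [← LinearMap.range_comp, ← e2, LinearEquiv.range_comp]
  have hk : LinearMap.ker (cycBnd (N + 1) P (M + 1))
      = (LinearMap.ker (π ∘ₗ bd N M)).map L2.toLinearMap := by
    rw [← e1, LinearMap.ker_comp, Submodule.map_comap_eq_of_surjective L2.surjective]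
  have hle : LinearMap.range (cycBnd (N + 1) P (M + 2))
      ≤ LinearMap.ker (cycBnd (N + 1) P (M + 1)) := by
    rw [hr, hk]
    apply Submodule.map_mono
    rintro _ ⟨c, rfl⟩
    rw [LinearMap.mem_ker, LinearMap.comp_apply, bd_bd, map_zero]
  have h := finrank_homologyOf hle
  have h4 : Module.finrank ℚ (LinearMap.range (cycBnd (N + 1) P (M + 2)))
      = Module.finrank ℚ (LinearMap.range (bd N (M + 1))) := by
    rw [hr, LinearEquiv.finrank_map_eq]
  have h5 : Module.finrank ℚ (LinearMap.ker (cycBnd (N + 1) P (M + 1)))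
      = Module.finrank ℚ (LinearMap.ker (bd N M))
        + Module.finrank ℚ (LinearMap.range (bd N M) ⊓ W : Submodule ℚ (Cell N M → ℚ)) := by
    rw [hk, LinearEquiv.finrank_map_eq, finrank_ker_comp, hπ]
  rw [h4, h5, finrank_ker_bd] at h
  omega

end Transfer

lemma completeFree_of_lt {N k m : ℕ} (hk : 0 < k) (hm : N + 2 < m + k) (f : Fin (N + 1) → Fin m)
    (hf : Surjective f) : completeFree (N + 1) k m f := by
  intro e he i
  by_contra! hc
  obtain ⟨s, hs⟩ := Finset.card_pos.1 (he ▸ hk)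
  have h1 : (insert s eᶜ).image f = Finset.univ := by
    apply Finset.eq_univ_of_forall
    intro i
    obtain ⟨x, rfl⟩ := hf i
    rw [Finset.mem_image]
    by_cases hx : x ∈ e
    · exact ⟨s, by simp, (hc s hs).trans (hc x hx).symm⟩
    · exact ⟨x, by simp [hx], rfl⟩
  have h2 := Finset.card_image_le (s := insert s eᶜ) (f := f)
  have h3 := Finset.card_le_univ e
  rw [h1, Finset.card_univ, Fintype.card_fin, Finset.card_insert_of_notMem (by simpa using hs),
    Finset.card_compl, Fintype.card_fin] at h2
  rw [Fintype.card_fin] at h3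
  omega

lemma mem_bigChains_iff {N M k : ℕ} (hk : 0 < k) (c : Cell N M → ℚ) : c ∈ bigChains N M k ↔
    ∀ g : CycBas (N + 1) (completeFree (N + 1) k) (M + 1), c (toCell g) = 0 := by
  constructor
  · intro h g
    by_contra hg
    obtain ⟨S, hS, hc⟩ := h _ hg
    obtain ⟨s, hs⟩ := Finset.card_pos.1 (hS ▸ hk)
    obtain ⟨x, hx, hne⟩ := g.2.2.2 S hS (g.1 s)
    exact hne (hc x hx s hs)
  · intro h f hf
    by_contra hbig
    refine hf (h ⟨f.1, f.2.1, fun x hx => ?_, fun e he i => ?_⟩)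
    · obtain rfl : x = 0 := Fin.ext hx
      exact cell_zero f
    · by_contra! hc
      exact hbig ⟨e, he, fun x hx y hy => (hc x hx).trans (hc y hy).symm⟩

end CyclicColoring

/-- Theorem (paper Thm. `Homology_Complement`): for the complete `k`-uniform hypergraph `H`
on `n` vertices (`3 ≤ k ≤ n-1`), the quotient complex `Δ(H)^C = Δ(E_n)/Δ(H)` satisfies
`dim HC_r(Δ(H)^C) = C(n-1, r+1)` for `n-2 ≥ r > n-k`, and
`dim HC_{n-k}(Δ(H)^C) = C(n-1, n-k-1) + C(n-1, n-k+1)`.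
Below `q = r + 1`; homological degree `r` corresponds to partitions with `q + 1` blocks. -/
theorem dim_HC_complement_complete (n k : ℕ) (hk : 3 ≤ k) (hkn : k ≤ n - 1) :
    (∀ q : ℕ, n - k + 2 ≤ q → q ≤ n - 1 →
      Module.finrank ℚ (homologyOf (cycBnd n (completeFree n k) (q + 1))
        (cycBnd n (completeFree n k) q)) = Nat.choose (n - 1) q) ∧
    Module.finrank ℚ (homologyOf (cycBnd n (completeFree n k) (n - k + 1 + 1))
        (cycBnd n (completeFree n k) (n - k + 1))) =
      Nat.choose (n - 1) (n - k - 1) + Nat.choose (n - 1) (n - k + 1) := by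
  obtain ⟨N, rfl⟩ : ∃ N, n = N + 1 := ⟨n - 1, by omega⟩
  constructor
  · intro q hq hqn
    obtain ⟨M, rfl⟩ : ∃ M, q = M + 1 := ⟨q - 1, by omega⟩
    have h := CyclicColoring.finrank_homology (P := completeFree (N + 1) k) (M := M)
      (CyclicColoring.completeFree_of_lt (by omega) (by omega))
      (CyclicColoring.completeFree_of_lt (by omega) (by omega)) ⊥ fun c => ?_
    · rw [inf_bot_eq, finrank_bot, add_zero] at h
      exact h
    · rw [Submodule.mem_bot]
      refine ⟨fun hc g => by simp [hc], fun hc => funext fun f => ?_⟩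
      obtain ⟨g, rfl⟩ := CyclicColoring.toCell_surjective (M := M) (P := completeFree (N + 1) k)
        (CyclicColoring.completeFree_of_lt (by omega) (by omega)) f
      exact hc g
  · obtain ⟨M, hM⟩ : ∃ M, N + 1 - k = M + 1 := ⟨N - k, by omega⟩
    rw [hM]
    have h := CyclicColoring.finrank_homology (P := completeFree (N + 1) k) (M := M + 1)
      (CyclicColoring.completeFree_of_lt (by omega) (by omega))
      (CyclicColoring.completeFree_of_lt (by omega) (by omega)) _
      (CyclicColoring.mem_bigChains_iff (by omega))
    rw [CyclicColoring.finrank_range_bd_inf_bigChains hk (by omega)] at h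
    rw [h, add_comm]
    rfl
end

section
/- Let 3 ≤ k ≤ n−1 and let H be the complete k-uniform hypergraph on {1,...,n}. Then dim HC_{n−k−1}(Δ(H)) = C(n, n−k). -/
open Function

/-- Cyclic merging of the blocks `j` and `j + 1` of a sequence of blocks indexed by
`0, …, m`, where the successor of the block `m` is the block `0`. -/
def cycMerge (m j x : ℕ) : ℕ := if x ≤ j then (if x = m then 0 else x) else x - 1

lemma cycMat_eq_sum {n : ℕ} {P : (m : ℕ) → (Fin n → Fin m) → Prop} {m : ℕ}
    (f : CycBas n P (m + 1)) (g : CycBas n P m) :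
    cycMat n P m f g = ∑ j : Fin (m + 1), (-1 : ℚ) ^ (j : ℕ) *
      (if ∀ y, cycMerge m j (f.1 y) = (g.1 y : ℕ) then 1 else 0) := by
  rw [Fin.sum_univ_castSucc, cycMat]
  congr 1
  · refine Finset.sum_congr rfl fun j _ => ?_
    congr 2
    rw [funext_iff]
    refine propext (forall_congr' fun y => ?_)
    rw [Fin.ext_iff]
    have := j.isLt
    simp only [Function.comp, mergeMap, cycMerge, Fin.val_castSucc]
    split_ifs <;> simp_all
    omega
  · congr 2
    refine propext (forall_congr' fun y => ?_)
    have := (f.1 y).isLt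
    simp only [cycMerge, Fin.val_last]
    split_ifs <;> simp_all <;> omega

/-- The permutation of `{0, …, m + 1}` fixing `0` and decreasing the other elements cyclically. -/
def rotNonzero (m : ℕ) : Equiv.Perm (Fin (m + 2)) :=
  Equiv.Perm.decomposeFin.symm (0, (finRotate (m + 1))⁻¹)

lemma rotNonzero_zero (m : ℕ) : rotNonzero m 0 = 0 := by
  simp [rotNonzero]

lemma rotNonzero_inv_zero (m : ℕ) : (rotNonzero m)⁻¹ 0 = 0 := by
  rw [Equiv.Perm.inv_eq_iff_eq, rotNonzero_zero]

lemma val_rotNonzero_inv (m : ℕ) (x : Fin (m + 2)) :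
    ((rotNonzero m)⁻¹ x : ℕ) =
      if (x : ℕ) = 0 then (0 : ℕ) else if (x : ℕ) = m + 1 then 1 else (x : ℕ) + 1 := by
  obtain rfl | ⟨y, rfl⟩ := Fin.eq_zero_or_eq_succ x
  · simp [rotNonzero_inv_zero]
  · have h : (rotNonzero m)⁻¹ y.succ = (finRotate (m + 1) y).succ := by
      rw [Equiv.Perm.inv_eq_iff_eq]
      simp [rotNonzero]
    rw [h, Fin.val_succ, coe_finRotate]
    simp only [Fin.ext_iff, Fin.val_last, Fin.val_succ]
    split_ifs <;> omega

lemma val_rotNonzero (m : ℕ) (x : Fin (m + 2)) :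
    (rotNonzero m x : ℕ) =
      if (x : ℕ) = 0 then (0 : ℕ) else if (x : ℕ) = 1 then m + 1 else (x : ℕ) - 1 := by
  have h := val_rotNonzero_inv m (rotNonzero m x)
  rw [← Equiv.Perm.mul_apply, inv_mul_cancel, Equiv.Perm.one_apply] at h
  have := (rotNonzero m x).isLt
  split_ifs at h ⊢ <;> omega

lemma sign_rotNonzero (m : ℕ) : Equiv.Perm.sign (rotNonzero m) = (-1) ^ m := by
  rw [rotNonzero, Equiv.Perm.decomposeFin.symm_sign]
  simp

/-- The permutation of the blocks which exchanges the cyclically consecutive blocks `j` and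
`j + 1` and then rotates the block `0` back to its place. -/
def cycSwap (m : ℕ) (j : Fin (m + 2)) : Equiv.Perm (Fin (m + 2)) :=
  if j = 0 then rotNonzero m else if j = Fin.last (m + 1) then (rotNonzero m)⁻¹
  else Equiv.swap j (j + 1)

/-- The position of the block `j` after applying `cycSwap m j`, as an index of a cyclic merge. -/
def cycSwapIdx (m : ℕ) (j : Fin (m + 2)) : Fin (m + 2) :=
  if j = 0 then Fin.last (m + 1) else if j = Fin.last (m + 1) then 0 else j

lemma val_cycSwapIdx (m : ℕ) (j : Fin (m + 2)) : (cycSwapIdx m j : ℕ) =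
    if (j : ℕ) = 0 then m + 1 else if (j : ℕ) = m + 1 then 0 else (j : ℕ) := by
  simp only [cycSwapIdx, Fin.ext_iff, Fin.val_zero, Fin.val_last]
  split_ifs <;> simp_all

lemma cycSwapIdx_involutive (m : ℕ) : Involutive (cycSwapIdx m) := fun j => by
  apply Fin.ext
  simp only [val_cycSwapIdx]
  split_ifs <;> first | omega | contradiction

lemma val_add_one_of_ne_last {m : ℕ} {j : Fin (m + 2)} (h : (j : ℕ) ≠ m + 1) :
    ((j + 1 : Fin (m + 2)) : ℕ) = j + 1 := by
  rw [Fin.val_add_one, if_neg]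
  simpa [Fin.ext_iff] using h

lemma val_cycSwap (m : ℕ) (j x : Fin (m + 2)) : (cycSwap m j x : ℕ) =
    if (j : ℕ) = 0 then (if (x : ℕ) = 0 then (0 : ℕ) else if (x : ℕ) = 1 then m + 1 else (x : ℕ) - 1)
    else if (j : ℕ) = m + 1 then
      (if (x : ℕ) = 0 then (0 : ℕ) else if (x : ℕ) = m + 1 then 1 else (x : ℕ) + 1)
    else if (x : ℕ) = j then (j : ℕ) + 1 else if (x : ℕ) = j + 1 then (j : ℕ) else (x : ℕ) := by
  by_cases h0 : (j : ℕ) = 0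
  · have : j = 0 := Fin.ext h0
    simp [cycSwap, this, val_rotNonzero]
  by_cases h1 : (j : ℕ) = m + 1
  · have h1' : j = Fin.last (m + 1) := Fin.ext h1
    have h0' : Fin.last (m + 1) ≠ 0 := by simp [Fin.ext_iff]
    rw [if_neg h0, if_pos h1, cycSwap, if_neg (h1' ▸ h0'), if_pos h1', val_rotNonzero_inv]
  · have h0' : j ≠ 0 := fun h => h0 (by simp [h])
    have h1' : j ≠ Fin.last (m + 1) := fun h => h1 (by simp [h])
    have := val_add_one_of_ne_last h1
    rw [if_neg h0, if_neg h1, cycSwap, if_neg h0', if_neg h1', Equiv.swap_apply_def]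
    simp only [Fin.ext_iff, this]
    split_ifs <;> simp_all

lemma cycSwap_zero (m : ℕ) (j : Fin (m + 2)) : cycSwap m j 0 = 0 := by
  apply Fin.ext
  rw [val_cycSwap]
  simp only [Fin.val_zero]
  split_ifs <;> first | omega | contradiction

lemma cycMerge_cycSwap (m : ℕ) (j x : Fin (m + 2)) :
    cycMerge (m + 1) (cycSwapIdx m j) (cycSwap m j x) = cycMerge (m + 1) j x := by
  have := x.isLt
  have := j.isLt
  simp only [cycMerge, val_cycSwapIdx, val_cycSwap]
  split_ifs <;> omega

lemma sign_cycSwap (m : ℕ) (j : Fin (m + 2)) :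
    (-1 : ℚ) ^ (cycSwapIdx m j : ℕ) * ((Equiv.Perm.sign (cycSwap m j) : ℤ) : ℚ) =
      -(-1) ^ (j : ℕ) := by
  have hsq : (-1 : ℚ) ^ m * (-1) ^ m = 1 := by rw [← mul_pow]; simp
  by_cases h0 : (j : ℕ) = 0
  · have : j = 0 := Fin.ext h0
    subst this
    simp [cycSwap, cycSwapIdx, sign_rotNonzero, pow_succ, hsq]
  have h0' : j ≠ 0 := fun h => h0 (by simp [h])
  by_cases h1 : (j : ℕ) = m + 1
  · have h1' : j = Fin.last (m + 1) := Fin.ext h1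
    rw [val_cycSwapIdx, if_neg h0, if_pos h1, cycSwap, if_neg h0', if_pos h1',
      Equiv.Perm.sign_inv, sign_rotNonzero, h1]
    simp [pow_succ]
  · have h1' : j ≠ Fin.last (m + 1) := fun h => h1 (by simp [h])
    have h2 : j ≠ j + 1 := fun h => by
      have := val_add_one_of_ne_last h1
      rw [← h] at this
      omega
    rw [val_cycSwapIdx, if_neg h0, if_neg h1, cycSwap, if_neg h0', if_neg h1',
      Equiv.Perm.sign_swap h2]
    simp

/-- A partition of `n` vertices into `m` blocks one of which contains a `k`-set `e` has
`m ≤ n - k + 1`, and in case of equality `e` is a block and all other blocks are singletons. -/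
lemma Function.Surjective.fiber_of_card {n k m : ℕ} {f : Fin n → Fin (m + 1)} (hf : Surjective f)
    {e : Finset (Fin n)} (he : e.card = k) {i : Fin (m + 1)} (hi : ∀ x ∈ e, f x = i) :
    m + k ≤ n ∧ (n = m + k → (∀ x, f x = i ↔ x ∈ e) ∧
      ∀ x y, f x = f y → x = y ∨ (x ∈ e ∧ y ∈ e)) := by
  have hsub : Finset.univ.erase i ⊆ eᶜ.image f := fun b hb => by
    obtain ⟨x, rfl⟩ := hf b
    refine Finset.mem_image_of_mem f (Finset.mem_compl.2 fun hx => ?_)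
    exact (Finset.mem_erase.1 hb).1 (hi x hx)
  have hcard : (Finset.univ.erase i).card = m := by simp
  have hcompl : eᶜ.card = n - k := by rw [Finset.card_compl, he, Fintype.card_fin]
  have hkn : k ≤ n := by simpa [he] using Finset.card_le_univ e
  have h1 := Finset.card_le_card hsub
  have h2 : (eᶜ.image f).card ≤ eᶜ.card := Finset.card_image_le
  refine ⟨by omega, fun hn => ?_⟩
  have himg : Finset.univ.erase i = eᶜ.image f := Finset.eq_of_subset_of_card_le hsub (by omega)
  have hinj : Set.InjOn f (eᶜ : Finset (Fin n)) := Finset.card_image_iff.1 (by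
    rw [← himg]; omega)
  have hne : ∀ x, x ∉ e → f x ≠ i := fun x hx => by
    have : f x ∈ Finset.univ.erase i := by
      rw [himg]; exact Finset.mem_image_of_mem f (Finset.mem_compl.2 hx)
    exact (Finset.mem_erase.1 this).1
  refine ⟨fun x => ⟨fun h => ?_, hi x⟩, fun x y hxy => ?_⟩
  · by_contra hx
    exact hne x hx h
  · by_cases hx : x ∈ e
    · refine Or.inr ⟨hx, ?_⟩
      by_contra hy
      exact hne y hy (hxy ▸ hi x hx)
    · by_cases hy : y ∈ e
      · exact absurd (hxy ▸ hi y hy) (hne x hx)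
      · exact Or.inl (hinj (by simpa using hx) (by simpa using hy) hxy)

lemma isEmpty_cycBas {n k m : ℕ} (h : n < m + k) : IsEmpty (CycBas n (completeIn n k) (m + 1)) :=
  ⟨fun f => by
    obtain ⟨e, he, i, hi⟩ := f.2.2.2
    have := (f.2.1.fiber_of_card he hi).1
    omega⟩

namespace CycBas

variable {n k m : ℕ}

/-- A `k`-set contained in a block of `f`. -/
noncomputable def edge (f : CycBas n (completeIn n k) m) : Finset (Fin n) :=
  f.2.2.2.choose

/-- A block of `f` containing a `k`-set. -/
noncomputable def bigBlock (f : CycBas n (completeIn n k) m) : Fin m :=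
  f.2.2.2.choose_spec.2.choose

lemma card_edge (f : CycBas n (completeIn n k) m) : f.edge.card = k :=
  f.2.2.2.choose_spec.1

lemma apply_of_mem_edge (f : CycBas n (completeIn n k) m) {x : Fin n} (hx : x ∈ f.edge) :
    f.1 x = f.bigBlock :=
  f.2.2.2.choose_spec.2.choose_spec x hx

lemma apply_eq_bigBlock_iff (hn : n = m + k) (f : CycBas n (completeIn n k) (m + 1)) (x : Fin n) :
    f.1 x = f.bigBlock ↔ x ∈ f.edge :=
  ((f.2.1.fiber_of_card f.card_edge fun _ => f.apply_of_mem_edge).2 hn).1 x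

lemma eq_or_mem_edge (hn : n = m + k) (f : CycBas n (completeIn n k) (m + 1)) {x y : Fin n}
    (h : f.1 x = f.1 y) : x = y ∨ (x ∈ f.edge ∧ y ∈ f.edge) :=
  ((f.2.1.fiber_of_card f.card_edge fun _ => f.apply_of_mem_edge).2 hn).2 x y h

lemma eq_edge (hn : n = m + k) (hk : 2 ≤ k) (f : CycBas n (completeIn n k) (m + 1))
    {e : Finset (Fin n)} (he : e.card = k) {i : Fin (m + 1)} (hi : ∀ x ∈ e, f.1 x = i) :
    e = f.edge := by
  obtain ⟨x, hx, y, hy, hxy⟩ := Finset.one_lt_card.1 (show 1 < e.card by omega)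
  have hxe := ((f.eq_or_mem_edge hn ((hi x hx).trans (hi y hy).symm)).resolve_left hxy).1
  refine Finset.eq_of_subset_of_card_le (fun z hz => ?_) (by rw [he, f.card_edge])
  rw [← f.apply_eq_bigBlock_iff hn, hi z hz, ← hi x hx, f.apply_of_mem_edge hxe]

/-- The action on faces of the permutations of the blocks which fix the block `0`. -/
def act (π : Equiv.Perm (Fin (m + 1))) (hπ : π 0 = 0) (f : CycBas n (completeIn n k) (m + 1)) :
    CycBas n (completeIn n k) (m + 1) :=
  ⟨π ∘ f.1, π.surjective.comp f.2.1, fun x hx => by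
    have : f.1 x = 0 := Fin.ext (f.2.2.1 x hx)
    simp [this, hπ], by
    obtain ⟨e, he, i, hi⟩ := f.2.2.2
    exact ⟨e, he, π i, fun x hx => congrArg π (hi x hx)⟩⟩

@[simp] lemma act_apply (π : Equiv.Perm (Fin (m + 1))) (hπ : π 0 = 0)
    (f : CycBas n (completeIn n k) (m + 1)) (x : Fin n) : (f.act π hπ).1 x = π (f.1 x) := rfl

lemma act_bijective (π : Equiv.Perm (Fin (m + 1))) (hπ : π 0 = 0) :
    Bijective (act π hπ : CycBas n (completeIn n k) (m + 1) → _) :=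
  Finite.injective_iff_bijective.1 fun _ _ h => Subtype.ext (funext fun x =>
    π.injective (congrFun (congrArg Subtype.val h) x))

lemma edge_act (hn : n = m + k) (hk : 2 ≤ k) (π : Equiv.Perm (Fin (m + 1))) (hπ : π 0 = 0)
    (f : CycBas n (completeIn n k) (m + 1)) : (f.act π hπ).edge = f.edge :=
  ((f.act π hπ).eq_edge hn hk f.card_edge (i := π f.bigBlock)
    fun _ hx => congrArg π (f.apply_of_mem_edge hx)).symm

lemma bigBlock_act (hn : n = m + k) (hk : 2 ≤ k) (π : Equiv.Perm (Fin (m + 1))) (hπ : π 0 = 0)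
    (f : CycBas n (completeIn n k) (m + 1)) : (f.act π hπ).bigBlock = π f.bigBlock := by
  obtain ⟨x, hx⟩ := Finset.card_pos.1 (show 0 < f.edge.card by rw [f.card_edge]; omega)
  rw [← (f.act π hπ).apply_of_mem_edge (x := x) (by rwa [edge_act hn hk]), act_apply,
    f.apply_of_mem_edge hx]

lemma eq_of_act_eq {π π' : Equiv.Perm (Fin (m + 1))} {hπ : π 0 = 0} {hπ' : π' 0 = 0}
    {f : CycBas n (completeIn n k) (m + 1)} (h : f.act π hπ = f.act π' hπ') : π = π' :=
  Equiv.ext fun i => by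
    obtain ⟨x, rfl⟩ := f.2.1 i
    exact congrFun (congrArg Subtype.val h) x

lemma exists_act_eq (hn : n = m + k) (hk : 2 ≤ k) {f f' : CycBas n (completeIn n k) (m + 1)}
    (h : f.edge = f'.edge) : ∃ (π : Equiv.Perm (Fin (m + 1))) (hπ : π 0 = 0), f.act π hπ = f' := by
  have key : ∀ x y, f.1 x = f.1 y → f'.1 x = f'.1 y := fun x y hxy => by
    obtain rfl | ⟨hx, hy⟩ := f.eq_or_mem_edge hn hxy
    · rfl
    · rw [f'.apply_of_mem_edge (h ▸ hx), f'.apply_of_mem_edge (h ▸ hy)]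
  have hval : ∀ x, f'.1 (surjInv f.2.1 (f.1 x)) = f'.1 x := fun x =>
    key _ _ (surjInv_eq f.2.1 (f.1 x))
  have hsurj : Surjective fun i => f'.1 (surjInv f.2.1 i) := fun i => by
    obtain ⟨x, rfl⟩ := f'.2.1 i
    exact ⟨f.1 x, hval x⟩
  have hpos : 0 < n := by omega
  have h0 := hval ⟨0, hpos⟩
  rw [show f.1 ⟨0, hpos⟩ = 0 from Fin.ext (f.2.2.1 _ rfl),
    show f'.1 ⟨0, hpos⟩ = 0 from Fin.ext (f'.2.2.1 _ rfl)] at h0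
  exact ⟨Equiv.ofBijective _ (Finite.surjective_iff_bijective.1 hsurj), h0,
    Subtype.ext (funext hval)⟩

lemma exists_edge_eq (hn : n = m + k) (hk : 2 ≤ k) {e : Finset (Fin n)} (he : e.card = k) :
    ∃ f : CycBas n (completeIn n k) (m + 1), f.edge = e := by
  obtain ⟨x₀, hx₀⟩ := Finset.card_pos.1 (show 0 < e.card by omega)
  have hcard : Fintype.card {x // x ∈ insert x₀ eᶜ} = m + 1 := by
    rw [Fintype.card_coe, Finset.card_insert_of_notMem (by simpa using hx₀), Finset.card_compl, he,
      Fintype.card_fin]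
    omega
  let q : Fin n → {x // x ∈ insert x₀ eᶜ} := fun x =>
    if h : x ∈ e then ⟨x₀, by simp⟩ else ⟨x, by simp [h]⟩
  have hq : Surjective q := fun ⟨x, hx⟩ => by
    refine ⟨x, ?_⟩
    by_cases h : x ∈ e
    · have : x = x₀ := by simpa [h] using hx
      subst this
      simp [q, h]
    · simp [q, h]
  have hpos : 0 < n := by omega
  let φ := Fintype.equivFinOfCardEq hcard
  let ψ := φ.trans (Equiv.swap (φ (q ⟨0, hpos⟩)) 0)
  have hin : ∀ x ∈ e, (ψ ∘ q) x = ψ ⟨x₀, by simp⟩ := fun x hx => by simp [q, hx]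
  let f : CycBas n (completeIn n k) (m + 1) :=
    ⟨ψ ∘ q, ψ.surjective.comp hq, fun x hx => by
      have : x = ⟨0, hpos⟩ := Fin.ext hx
      simp [ψ, this], ⟨e, he, _, hin⟩⟩
  exact ⟨f, (f.eq_edge hn hk he hin).symm⟩

end CycBas

lemma cycMerge_eq_iff {m : ℕ} (j x y : Fin (m + 2)) :
    cycMerge (m + 1) j x = cycMerge (m + 1) j y ↔
      x = y ∨ (x = j ∧ y = j + 1) ∨ (x = j + 1 ∧ y = j) := by
  have := x.isLt
  have := y.isLt
  have := j.isLt
  have hj : ((j + 1 : Fin (m + 2)) : ℕ) = if (j : ℕ) = m + 1 then 0 else (j : ℕ) + 1 := by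
    split_ifs with h
    · simp [show j = Fin.last (m + 1) from Fin.ext h]
    · exact val_add_one_of_ne_last h
  simp only [cycMerge, Fin.ext_iff, hj]
  split_ifs <;> omega

lemma eq_or_eq_cycSwapIdx {m : ℕ} {j j' : Fin (m + 2)}
    (h : cycMerge (m + 1) j' j' = cycMerge (m + 1) j j) : j' = j ∨ j' = cycSwapIdx m j := by
  have := j.isLt
  have := j'.isLt
  simp only [Fin.ext_iff, val_cycSwapIdx]
  simp only [cycMerge, le_refl, if_true] at h
  split_ifs at h ⊢ <;> omega

lemma cycMerge_lt {m : ℕ} (j x : Fin (m + 2)) : cycMerge (m + 1) j x < m + 1 := by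
  have := x.isLt
  have := j.isLt
  simp only [cycMerge]
  split_ifs <;> omega

lemma ne_add_one {m : ℕ} (j : Fin (m + 2)) : j ≠ j + 1 := by simp

namespace CycBas

variable {n k m : ℕ}

/-- The face obtained from `f` by merging the cyclically consecutive blocks `j` and `j + 1`. -/
def merge (j : Fin (m + 2)) (f : CycBas n (completeIn n k) (m + 2)) :
    CycBas n (completeIn n k) (m + 1) :=
  ⟨fun y => ⟨cycMerge (m + 1) j (f.1 y), cycMerge_lt j _⟩, fun i => by
      obtain ⟨y, hy⟩ := f.2.1 (if (i : ℕ) ≤ j then i.castSucc else i.succ)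
      refine ⟨y, Fin.ext ?_⟩
      have := i.isLt
      simp only [hy, cycMerge]
      split_ifs <;> simp_all <;> omega,
    fun x hx => by simp [f.2.2.1 x hx, cycMerge], by
    obtain ⟨e, he, i, hi⟩ := f.2.2.2
    exact ⟨e, he, ⟨cycMerge (m + 1) j i, cycMerge_lt j i⟩, fun y hy =>
      Fin.ext (congrArg (fun v : Fin (m + 2) => cycMerge (m + 1) j v) (hi y hy))⟩⟩

lemma eq_of_apply_eq (hn : n = m + k) {f : CycBas n (completeIn n k) (m + 1)} {x y : Fin n}
    (h : f.1 x = f.1 y) (hx : f.bigBlock ≠ f.1 x) : x = y :=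
  (f.eq_or_mem_edge hn h).resolve_right fun hE => hx (f.apply_of_mem_edge hE.1).symm

/-- Faces which agree after merging the singleton blocks `j` and `j + 1` are equal or differ by
exchanging these two blocks. -/
lemma eq_or_eq_act_cycSwap (hn : n = m + 1 + k)
    {f f' : CycBas n (completeIn n k) (m + 2)} {j : Fin (m + 2)}
    (hj : f.bigBlock ≠ j) (hj1 : f.bigBlock ≠ j + 1)
    (h : ∀ y, cycMerge (m + 1) j (f'.1 y) = cycMerge (m + 1) j (f.1 y)) :
    f' = f ∨ (cycSwapIdx m j = j ∧ f' = f.act (cycSwap m j) (cycSwap_zero m j)) := by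
  simp only [cycMerge_eq_iff] at h
  obtain ⟨a, ha⟩ := f.2.1 j
  obtain ⟨b, hb⟩ := f.2.1 (j + 1)
  have hfa : ∀ y, f.1 y = j → y = a := fun y hy =>
    eq_of_apply_eq hn (hy.trans ha.symm) (hy ▸ hj)
  have hfb : ∀ y, f.1 y = j + 1 → y = b := fun y hy =>
    eq_of_apply_eq hn (hy.trans hb.symm) (hy ▸ hj1)
  have hne := ne_add_one j
  have hother : ∀ y, y ≠ a → y ≠ b → f'.1 y = f.1 y := fun y hya hyb => by
    rcases h y with h | h | h
    · exact h
    · exact absurd (hfb y h.2) hyb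
    · exact absurd (hfa y h.2) hya
  have hpre : ∀ y, (f'.1 y = j ∨ f'.1 y = j + 1) → y = a ∨ y = b := fun y hy => by
    by_contra! hcon
    rw [hother y hcon.1 hcon.2] at hy
    rcases hy with hy | hy
    exacts [hcon.1 (hfa y hy), hcon.2 (hfb y hy)]
  obtain ⟨a', ha'⟩ := f'.2.1 j
  obtain ⟨b', hb'⟩ := f'.2.1 (j + 1)
  rcases hpre a' (Or.inl ha') with rfl | rfl
  · left
    have hbb : b' = b := (hpre b' (Or.inr hb')).resolve_left fun h => hne
      (ha'.symm.trans ((congrArg f'.1 h).symm.trans hb'))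
    subst hbb
    refine Subtype.ext (funext fun y => ?_)
    by_cases hya : y = a'
    · rw [hya, ha', ha]
    by_cases hyb : y = b'
    · rw [hyb, hb', hb]
    exact hother y hya hyb
  · right
    have hbb : b' = a := (hpre b' (Or.inr hb')).resolve_right fun h => hne
      (ha'.symm.trans ((congrArg f'.1 h).symm.trans hb'))
    subst hbb
    have hpos : 0 < n := by omega
    have hf0 : f.1 ⟨0, hpos⟩ = 0 := Fin.ext (f.2.2.1 _ rfl)
    have hf0' : f'.1 ⟨0, hpos⟩ = 0 := Fin.ext (f'.2.2.1 _ rfl)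
    have h0 : j ≠ 0 := fun h0 => hne (by
      rw [← hb', ← hfa _ (hf0.trans h0.symm), hf0', h0])
    have h1 : j ≠ Fin.last (m + 1) := fun h1 => by
      have h2 : j + 1 = 0 := by simp [h1]
      exact hne (ha'.symm.trans ((congrArg f'.1 (hfb _ (hf0.trans h2.symm)).symm).trans
        (hf0'.trans h2.symm)))
    refine ⟨by simp [cycSwapIdx, h0, h1], Subtype.ext (funext fun y => ?_)⟩
    rw [act_apply, cycSwap, if_neg h0, if_neg h1]
    by_cases hya : y = a'
    · rw [hya, ha', hb, Equiv.swap_apply_right]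
    by_cases hyb : y = b'
    · rw [hyb, hb', ha, Equiv.swap_apply_left]
    rw [hother y hyb hya, Equiv.swap_apply_of_ne_of_ne (fun h => hyb (hfa y h))
      (fun h => hya (hfb y h))]

lemma eq_or_eq_of_cycMerge_eq (hn : n = m + 1 + k) (hk : 3 ≤ k)
    {f f' : CycBas n (completeIn n k) (m + 2)} {j j' : Fin (m + 2)}
    (hj : f.bigBlock ≠ j) (hj1 : f.bigBlock ≠ j + 1)
    (h : ∀ y, cycMerge (m + 1) j' (f'.1 y) = cycMerge (m + 1) j (f.1 y)) :
    (f', j') = (f, j) ∨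
      (f', j') = (f.act (cycSwap m j) (cycSwap_zero m j), cycSwapIdx m j) := by
  obtain ⟨a, ha⟩ := f.2.1 j
  obtain ⟨b, hb⟩ := f.2.1 (j + 1)
  have hmem : ∀ x y, f.1 x = j ∨ f.1 x = j + 1 → cycMerge (m + 1) j (f.1 x) =
      cycMerge (m + 1) j (f.1 y) → y ∈ ({a, b} : Finset (Fin n)) := fun x y hx hxy => by
    have hy : f.1 y = j ∨ f.1 y = j + 1 := by
      rw [cycMerge_eq_iff] at hxy
      rcases hxy with hxy | hxy | hxy
      exacts [hxy ▸ hx, Or.inr hxy.2, Or.inl hxy.2]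
    rw [Finset.mem_insert, Finset.mem_singleton]
    exact hy.imp (fun hy => eq_of_apply_eq hn (hy.trans ha.symm) (hy ▸ hj))
      fun hy => eq_of_apply_eq hn (hy.trans hb.symm) (hy ▸ hj1)
  have hE : ∀ x ∈ f'.edge, ∀ y ∈ f'.edge, f.1 x = f.1 y := fun x hx y hy => by
    have hmerge : ∀ z ∈ f'.edge, cycMerge (m + 1) j (f.1 x) = cycMerge (m + 1) j (f.1 z) :=
      fun z hz => by rw [← h, ← h, f'.apply_of_mem_edge hx, f'.apply_of_mem_edge hz]
    have hnot : ¬(f.1 x = j ∨ f.1 x = j + 1) := fun hx' => by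
      have h1 := Finset.card_le_card (fun z hz => hmem x z hx' (hmerge z hz) :
        f'.edge ⊆ {a, b})
      have h2 := Finset.card_le_two (a := a) (b := b)
      rw [f'.card_edge] at h1
      omega
    rcases (cycMerge_eq_iff _ _ _).1 (hmerge y hy) with h | h | h
    exacts [h, absurd (Or.inl h.1) hnot, absurd (Or.inr h.1) hnot]
  have hedge : f'.edge = f.edge := by
    obtain ⟨x, hx⟩ := Finset.card_pos.1 (show 0 < f'.edge.card by rw [f'.card_edge]; omega)
    exact f.eq_edge hn (by omega) f'.card_edge fun y hy => hE y hy x hx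
  obtain ⟨a', ha'⟩ := f'.2.1 j'
  obtain ⟨b', hb'⟩ := f'.2.1 (j' + 1)
  have hab : cycMerge (m + 1) j (f.1 a') = cycMerge (m + 1) j (f.1 b') := by
    rw [← h, ← h, ha', hb', cycMerge_eq_iff]
    exact Or.inr (Or.inl ⟨rfl, rfl⟩)
  have hidx : j' = j ∨ j' = cycSwapIdx m j := by
    apply eq_or_eq_cycSwapIdx
    have h1 := h a'
    rw [ha'] at h1
    rw [h1, cycMerge_eq_iff]
    rcases (cycMerge_eq_iff _ _ _).1 hab with h2 | h2 | h2
    · rcases f.eq_or_mem_edge hn h2 with rfl | hmem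
      · exact absurd (ha'.symm.trans hb') (ne_add_one j')
      · rw [← hedge] at hmem
        have h3 := (f'.apply_of_mem_edge hmem.1).trans (f'.apply_of_mem_edge hmem.2).symm
        exact absurd (ha'.symm.trans (h3.trans hb')) (ne_add_one j')
    · exact Or.inl h2.1
    · exact Or.inr (Or.inr ⟨h2.1, rfl⟩)
  rw [Prod.mk.injEq, Prod.mk.injEq]
  by_cases hjj : j' = j
  · subst hjj
    rcases eq_or_eq_act_cycSwap hn hj hj1 h with h | ⟨h, h'⟩
    exacts [Or.inl ⟨h, rfl⟩, Or.inr ⟨h', h.symm⟩]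
  · have hj' := hidx.resolve_left hjj
    subst hj'
    obtain ⟨f'', rfl⟩ := (act_bijective (cycSwap m j) (cycSwap_zero m j)).2 f'
    simp only [act_apply, cycMerge_cycSwap] at h
    rcases eq_or_eq_act_cycSwap hn hj hj1 h with h | ⟨h, -⟩
    exacts [Or.inr ⟨by rw [h], rfl⟩, absurd h hjj]

end CycBas

section Cycles

variable {n k m : ℕ}

open CycBas Equiv.Perm

lemma cycBnd_apply (c : CycBas n (completeIn n k) (m + 1) → ℚ) (g : CycBas n (completeIn n k) m) :
    cycBnd n (completeIn n k) m c g = ∑ p : CycBas n (completeIn n k) (m + 1) × Fin (m + 1),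
      c p.1 * ((-1 : ℚ) ^ (p.2 : ℕ) *
        (if ∀ y, cycMerge m p.2 (p.1.1 y) = (g.1 y : ℕ) then 1 else 0)) := by
  rw [Fintype.sum_prod_type]
  simp only [← Finset.mul_sum, ← cycMat_eq_sum]
  rfl

lemma apply_act_cycSwap (hn : n = m + 1 + k) (hk : 3 ≤ k)
    {c : CycBas n (completeIn n k) (m + 2) → ℚ} (hc : cycBnd n (completeIn n k) (m + 1) c = 0)
    (f : CycBas n (completeIn n k) (m + 2)) {j : Fin (m + 2)}
    (hj : f.bigBlock ≠ j) (hj1 : f.bigBlock ≠ j + 1) :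
    c (f.act (cycSwap m j) (cycSwap_zero m j)) = (sign (cycSwap m j) : ℤ) * c f := by
  have hne : (f, j) ≠ (f.act (cycSwap m j) (cycSwap_zero m j), cycSwapIdx m j) := fun h => by
    rw [Prod.mk.injEq] at h
    have h1 : f.act 1 rfl = f.act (cycSwap m j) (cycSwap_zero m j) := h.1
    have h2 := sign_cycSwap m j
    rw [← eq_of_act_eq h1, ← h.2] at h2
    have h3 : (-1 : ℚ) ^ (j : ℕ) ≠ 0 := pow_ne_zero _ (by norm_num)
    simp only [Equiv.Perm.sign_one, Units.val_one, Int.cast_one, mul_one] at h2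
    exact h3 (by linarith)
  have h := congrFun hc (f.merge j)
  rw [cycBnd_apply, Fintype.sum_eq_add _ _ hne fun p hp => ?_] at h
  · have h1 : ∀ y, cycMerge (m + 1) j (f.1 y) = ((f.merge j).1 y : ℕ) := fun _ => rfl
    have h2 : ∀ y, cycMerge (m + 1) (cycSwapIdx m j)
        ((f.act (cycSwap m j) (cycSwap_zero m j)).1 y) = ((f.merge j).1 y : ℕ) := fun y => by
      rw [act_apply, cycMerge_cycSwap, h1]
    dsimp only at h
    rw [if_pos h1, if_pos h2] at h
    have hs := sign_cycSwap m j
    have h3 : (-1 : ℚ) ^ (cycSwapIdx m j : ℕ) ≠ 0 := pow_ne_zero _ (by norm_num)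
    refine mul_left_cancel₀ h3 ?_
    rw [← mul_assoc, hs]
    simp only [mul_one, Pi.zero_apply] at h
    linarith
  · rw [if_neg fun hy => ?_, mul_zero, mul_zero]
    rcases eq_or_eq_of_cycMerge_eq hn hk hj hj1 (f' := p.1) (j' := p.2) hy with h | h
    exacts [hp.1 h, hp.2 h]

lemma apply_act_swap_succ (hn : n = m + 1 + k) (hk : 3 ≤ k)
    {c : CycBas n (completeIn n k) (m + 2) → ℚ} (hc : cycBnd n (completeIn n k) (m + 1) c = 0)
    (f : CycBas n (completeIn n k) (m + 2)) {x y : Fin (m + 2)}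
    (hx : f.bigBlock < x) (hy : (y : ℕ) = x + 1) (h0 : Equiv.swap x y 0 = 0) :
    c (f.act (Equiv.swap x y) h0) = -c f := by
  have hx0 : x ≠ 0 := Fin.ne_zero_of_lt hx
  have hx1 : (x : ℕ) ≠ m + 1 := by omega
  have hxl : x ≠ Fin.last (m + 1) := fun h => hx1 (by simp [h])
  have hyx : y = x + 1 := Fin.ext (by rw [val_add_one_of_ne_last hx1, hy])
  have hsw : cycSwap m x = Equiv.swap x y := by
    rw [cycSwap, if_neg hx0, if_neg hxl, hyx]
  have h := apply_act_cycSwap hn hk hc f (j := x) hx.ne (by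
    rw [← hyx]; intro h; rw [h] at hx; simp only [Fin.lt_def] at hx; omega)
  simp only [hsw] at h
  rw [h, sign_swap (hyx ▸ ne_add_one x)]
  simp

lemma apply_act_swap (hn : n = m + 1 + k) (hk : 3 ≤ k)
    {c : CycBas n (completeIn n k) (m + 2) → ℚ} (hc : cycBnd n (completeIn n k) (m + 1) c = 0)
    (d : ℕ) : ∀ (f : CycBas n (completeIn n k) (m + 2)) {x y : Fin (m + 2)}
    (_ : f.bigBlock < x) (_ : (y : ℕ) = x + d + 1) (h0 : Equiv.swap x y 0 = 0),
    c (f.act (Equiv.swap x y) h0) = -c f := by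
  induction d with
  | zero => exact fun f x y hx hy h0 => apply_act_swap_succ hn hk hc f hx hy h0
  | succ d ih =>
    intro f x y hx hy h0
    let z : Fin (m + 2) := ⟨x + d + 1, by omega⟩
    have hz : (z : ℕ) = x + d + 1 := rfl
    have hxn := Fin.lt_def.1 hx
    have hfix : ∀ {v w u : Fin (m + 2)}, u < v → u < w → Equiv.swap v w u = u :=
      fun hv hw => Equiv.swap_apply_of_ne_of_ne hv.ne hw.ne
    have hbz : f.bigBlock < z := Fin.lt_def.2 (by omega)
    have hby : f.bigBlock < y := Fin.lt_def.2 (by omega)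
    have hzy : Equiv.swap z y 0 = 0 := hfix ((Fin.zero_le _).trans_lt hbz) ((Fin.zero_le _).trans_lt hby)
    have hxz : Equiv.swap x z 0 = 0 := hfix ((Fin.zero_le _).trans_lt hx) ((Fin.zero_le _).trans_lt hbz)
    have hmul : Equiv.swap z y * Equiv.swap x z * Equiv.swap z y = Equiv.swap x y := by
      rw [Equiv.swap_comm x y]
      exact Equiv.swap_mul_swap_mul_swap
        (by simp only [ne_eq, Fin.ext_iff]; omega) (by simp only [ne_eq, Fin.ext_iff]; omega)
    have hact : f.act (Equiv.swap x y) h0 = ((f.act _ hzy).act _ hxz).act _ hzy :=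
      Subtype.ext (funext fun v => by
        simp only [act_apply, ← hmul, Equiv.Perm.mul_apply])
    have hb1 : (f.act _ hzy).bigBlock = f.bigBlock := by
      rw [bigBlock_act hn (by omega), hfix hbz hby]
    have hb2 : ((f.act _ hzy).act _ hxz).bigBlock = f.bigBlock := by
      rw [bigBlock_act hn (by omega), hb1, hfix hx hbz]
    rw [hact, apply_act_swap_succ hn hk hc _ (hb2 ▸ hbz) (by omega),
      ih _ (hb1 ▸ hx) hz, apply_act_swap_succ hn hk hc _ hbz (by omega), neg_neg]

lemma apply_act_of_fix_le (hn : n = m + 1 + k) (hk : 3 ≤ k)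
    {c : CycBas n (completeIn n k) (m + 2) → ℚ} (hc : cycBnd n (completeIn n k) (m + 1) c = 0)
    (f : CycBas n (completeIn n k) (m + 2)) (π : Equiv.Perm (Fin (m + 2))) (hπ : π 0 = 0)
    (h : ∀ i ≤ f.bigBlock, π i = i) : c (f.act π hπ) = (sign π : ℤ) * c f := by
  obtain ⟨p, hp⟩ : ∃ p, f.bigBlock = p := ⟨_, rfl⟩
  rw [hp] at h
  have hfix : ∀ σ : Equiv.Perm {i // p < i}, ∀ i ≤ p, ofSubtype σ i = i := fun σ i hi =>
    ofSubtype_apply_of_not_mem σ (not_lt.2 hi)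
  suffices H : ∀ (σ : Equiv.Perm {i // p < i}) (h0 : ofSubtype σ 0 = 0),
      c (f.act (ofSubtype σ) h0) = (sign σ : ℤ) * c f by
    have hmaps : ∀ i, p < i ↔ p < π i := fun i => by
      rw [← not_le, ← not_le, not_iff_not]
      refine ⟨fun hi => (h i hi).symm ▸ hi, fun hi => ?_⟩
      have := π.injective (h _ hi)
      rwa [this] at hi
    have hπσ : ofSubtype (π.subtypePerm fun i => (hmaps i).symm) = π :=
      ofSubtype_subtypePerm _ fun i hi => by
        by_contra hcon
        exact hi (h i (not_lt.1 hcon))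
    have h1 := H (π.subtypePerm fun i => (hmaps i).symm)
    rw [← sign_ofSubtype] at h1
    simp only [hπσ] at h1
    exact h1 hπ
  intro σ
  induction σ using swap_induction_on with
  | one =>
    intro h0
    have : f.act (ofSubtype 1) h0 = f := Subtype.ext (funext fun v => by simp)
    rw [this]
    simp
  | swap_mul σ x y hxy ih =>
    intro h0
    have hs0 : Equiv.swap (x : Fin (m + 2)) y 0 = 0 := Equiv.swap_apply_of_ne_of_ne
      ((Fin.zero_le _).trans_lt x.2).ne ((Fin.zero_le _).trans_lt y.2).ne
    have hσ0 := hfix σ 0 (Fin.zero_le p)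
    have hact : f.act (ofSubtype (Equiv.swap x y * σ)) h0 = (f.act _ hσ0).act _ hs0 :=
      Subtype.ext (funext fun v => by
        simp only [act_apply, map_mul, ofSubtype_swap_eq, Equiv.Perm.mul_apply])
    have hb : (f.act _ hσ0).bigBlock = p := by
      rw [bigBlock_act hn (by omega), hp, hfix σ p le_rfl]
    have hneg : c ((f.act _ hσ0).act _ hs0) = -c (f.act _ hσ0) := by
      rcases lt_or_gt_of_ne (fun h => hxy (Subtype.ext h) : (x : Fin (m + 2)) ≠ y) with hlt | hlt
      · have := Fin.lt_def.1 hlt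
        exact apply_act_swap hn hk hc ((y : Fin (m + 2)) - (x : Fin (m + 2)) - 1 : ℕ) _
          (hb.trans_lt x.2) (by omega) hs0
      · have := Fin.lt_def.1 hlt
        simp only [Equiv.swap_comm (x : Fin (m + 2)) y]
        exact apply_act_swap hn hk hc ((x : Fin (m + 2)) - (y : Fin (m + 2)) - 1 : ℕ) _
          (hb.trans_lt y.2) (by omega) _
    rw [hact, hneg, ih, Equiv.Perm.sign_mul, sign_swap hxy]
    simp

lemma exists_act_bigBlock_eq_one (hn : n = m + 1 + k) (hk : 3 ≤ k)
    {c : CycBas n (completeIn n k) (m + 2) → ℚ} (hc : cycBnd n (completeIn n k) (m + 1) c = 0)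
    (d : ℕ) : ∀ f : CycBas n (completeIn n k) (m + 2), (f.bigBlock : ℕ) = d + 1 →
    ∃ (π : Equiv.Perm (Fin (m + 2))) (hπ : π 0 = 0), (f.act π hπ).bigBlock = 1 ∧
      c (f.act π hπ) = (sign π : ℤ) * c f := by
  induction d with
  | zero =>
    intro f hf
    have h1 : f.act 1 rfl = f := rfl
    exact ⟨1, rfl, by rw [h1]; exact Fin.ext hf, by rw [h1]; simp⟩
  | succ d ih =>
    intro f hf
    have hb : ((f.act _ (cycSwap_zero m 0)).bigBlock : ℕ) = d + 1 := by
      rw [bigBlock_act hn (by omega), val_cycSwap]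
      simp [hf]
    obtain ⟨π, hπ, h1, h2⟩ := ih _ hb
    refine ⟨π * cycSwap m 0, by rw [Equiv.Perm.mul_apply, cycSwap_zero, hπ], h1, ?_⟩
    refine h2.trans ?_
    rw [apply_act_cycSwap hn hk hc f (by simp [Fin.ext_iff, hf]) (by simp [Fin.ext_iff, hf]),
      Equiv.Perm.sign_mul]
    push_cast
    ring

/-- Cycles are alternating under permutations of the blocks fixing the block `0`. -/
lemma apply_act (hn : n = m + 1 + k) (hk : 3 ≤ k)
    {c : CycBas n (completeIn n k) (m + 2) → ℚ} (hc : cycBnd n (completeIn n k) (m + 1) c = 0)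
    (f : CycBas n (completeIn n k) (m + 2)) (π : Equiv.Perm (Fin (m + 2))) (hπ : π 0 = 0) :
    c (f.act π hπ) = (sign π : ℤ) * c f := by
  by_cases hf : f.bigBlock = 0
  · refine apply_act_of_fix_le hn hk hc f π hπ fun i hi => ?_
    rw [hf, Fin.le_zero_iff] at hi
    rw [hi, hπ]
  have hf' : (f.act π hπ).bigBlock ≠ 0 := fun h => hf (π.injective (by
    rw [← bigBlock_act hn (by omega) π hπ, h, hπ]))
  have hpos : ∀ {i : Fin (m + 2)}, i ≠ 0 → (i : ℕ) = i - 1 + 1 := fun {i} hi => by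
    have : (i : ℕ) ≠ 0 := fun h => hi (Fin.ext h)
    omega
  obtain ⟨ρ, hρ, h1, h2⟩ := exists_act_bigBlock_eq_one hn hk hc _ f (hpos hf)
  obtain ⟨τ, hτ, h3, h4⟩ := exists_act_bigBlock_eq_one hn hk hc _ _ (hpos hf')
  have h0 : (τ * π * ρ⁻¹) 0 = 0 := by
    have : ρ⁻¹ 0 = 0 := by rw [Equiv.Perm.inv_eq_iff_eq, hρ]
    simp only [Equiv.Perm.mul_apply, this, hπ, hτ]
  have hact : (f.act ρ hρ).act (τ * π * ρ⁻¹) h0 = (f.act π hπ).act τ hτ :=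
    Subtype.ext (funext fun v => by simp [Equiv.Perm.mul_apply])
  have h5 := apply_act_of_fix_le hn hk hc (f.act ρ hρ) _ h0 fun i hi => by
    rw [h1] at hi
    have hi' : i = 0 ∨ i = 1 := by
      have := Fin.le_def.1 hi
      rw [Fin.val_one] at this
      rcases Nat.le_one_iff_eq_zero_or_eq_one.1 this with h | h
      exacts [Or.inl (Fin.ext h), Or.inr (Fin.ext h)]
    rcases hi' with rfl | rfl
    · exact h0
    · have h6 := bigBlock_act hn (by omega) _ h0 (f.act ρ hρ)
      rw [hact, h3, h1] at h6
      exact h6.symm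
  rw [hact, h4, h2, Equiv.Perm.sign_mul, Equiv.Perm.sign_mul, sign_inv] at h5
  have hsq : ∀ u : ℤˣ, ((u : ℤ) : ℚ) * ((u : ℤ) : ℚ) = 1 := fun u => by
    rcases Int.units_eq_one_or u with rfl | rfl <;> simp
  push_cast at h5
  have h7 := hsq (sign ρ)
  have h8 := hsq (sign τ)
  linear_combination ((sign τ : ℤ) : ℚ) * h5 + (-c (f.act π hπ) + (sign π : ℤ) * c f) * h8 +
    ((sign τ : ℤ) : ℚ) ^ 2 * (sign π : ℤ) * c f * h7

end Cycles

section Dimension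

variable {n k m : ℕ}

open CycBas Equiv.Perm

/-- Chains which are alternating under permutations of the blocks fixing the block `0` are
cycles. -/
lemma cycBnd_eq_zero {c : CycBas n (completeIn n k) (m + 2) → ℚ}
    (hc : ∀ f π (hπ : π 0 = 0), c (f.act π hπ) = (sign π : ℤ) * c f) :
    cycBnd n (completeIn n k) (m + 1) c = 0 := by
  funext g
  rw [cycBnd_apply]
  let e : Equiv.Perm (CycBas n (completeIn n k) (m + 2) × Fin (m + 2)) :=
    Equiv.ofBijective (fun p => (p.1.act (cycSwap m p.2) (cycSwap_zero m p.2), cycSwapIdx m p.2))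
      (Finite.injective_iff_bijective.1 fun p q h => by
        obtain ⟨h1, h2⟩ := Prod.mk.inj h
        have h3 := (cycSwapIdx_involutive m).injective h2
        obtain ⟨p, j⟩ := p
        obtain ⟨q, j'⟩ := q
        obtain rfl : j = j' := h3
        exact congrArg (·, j) ((act_bijective _ (cycSwap_zero m j)).1 h1))
  suffices h : ∀ S : ℚ, S = -S → S = 0 by
    apply h
    rw [← Finset.sum_neg_distrib]
    refine (Fintype.sum_equiv e _ _ fun p => ?_).symm
    obtain ⟨f, j⟩ := p
    have he : e (f, j) = (f.act (cycSwap m j) (cycSwap_zero m j), cycSwapIdx m j) := rfl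
    simp only [he, hc, act_apply, cycMerge_cycSwap]
    linear_combination (-c f * (if ∀ y, cycMerge (m + 1) j (f.1 y) = (g.1 y : ℕ) then 1 else 0)) *
      sign_cycSwap m j
  intro S hS
  linarith

lemma finrank_ker_cycBnd (hn : n = m + 1 + k) (hk : 3 ≤ k) :
    Module.finrank ℚ (LinearMap.ker (cycBnd n (completeIn n k) (m + 1))) = n.choose k := by
  choose base hbase using fun e : {e : Finset (Fin n) // e.card = k} =>
    exists_edge_eq (m := m + 1) hn (by omega) e.2
  choose π hπ hact using fun f : CycBas n (completeIn n k) (m + 2) =>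
    exists_act_eq hn (by omega) (hbase ⟨f.edge, f.card_edge⟩)
  have hmul : ∀ f σ (hσ : σ 0 = 0), π (f.act σ hσ) = σ * π f := fun f σ hσ => by
    have h1 := hact (f.act σ hσ)
    simp only [edge_act hn (show 2 ≤ k by omega)] at h1
    have h0 : (σ * π f) 0 = 0 := by rw [Equiv.Perm.mul_apply, hπ, hσ]
    exact eq_of_act_eq (hπ' := h0) (h1.trans (congrArg (act σ hσ) (hact f)).symm)
  let Φ : ({e : Finset (Fin n) // e.card = k} → ℚ) →ₗ[ℚ]
      (CycBas n (completeIn n k) (m + 2) → ℚ) :=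
    { toFun := fun h f => (sign (π f) : ℤ) * h ⟨f.edge, f.card_edge⟩
      map_add' := fun x y => by funext f; simp [mul_add]
      map_smul' := fun r x => by funext f; simp [mul_left_comm] }
  have hΦ : ∀ h f, Φ h f = (sign (π f) : ℤ) * h ⟨f.edge, f.card_edge⟩ := fun _ _ => rfl
  have hinj : Injective Φ := fun x y hxy => funext fun e => by
    have h1 := congrFun hxy (base e)
    rw [hΦ, hΦ] at h1
    have h2 : (⟨(base e).edge, (base e).card_edge⟩ : {e : Finset (Fin n) // e.card = k}) = e :=
      Subtype.ext (hbase e)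
    rw [h2] at h1
    refine mul_left_cancel₀ ?_ h1
    exact Int.cast_ne_zero.2 (Units.ne_zero _)
  have hrange : LinearMap.range Φ = LinearMap.ker (cycBnd n (completeIn n k) (m + 1)) := by
    apply le_antisymm
    · rintro _ ⟨h, rfl⟩
      refine cycBnd_eq_zero fun f σ hσ => ?_
      rw [hΦ, hΦ, hmul, Equiv.Perm.sign_mul]
      simp only [edge_act hn (show 2 ≤ k by omega)]
      push_cast
      ring
    · intro c hc
      refine ⟨fun e => c (base e), funext fun f => ?_⟩
      rw [hΦ, ← apply_act hn hk hc _ _ (hπ f), hact]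
  rw [← hrange, LinearMap.finrank_range_of_inj hinj, Module.finrank_fintype_fun_eq_card,
    Fintype.card_finset_len, Fintype.card_fin]

end Dimension

/-- Theorem (paper Thm. `MainResult`): for the complete `k`-uniform hypergraph `H` on `n`
vertices (`3 ≤ k ≤ n-1`), the `(n-k-1)`-st cyclic homology group of `Δ(H)` has dimension
`C(n, n-k)`.  The chain group in homological degree `r = n-k-1` consists of partitions with
`r + 2 = n-k+1` blocks. -/
theorem dim_HC_cyclic_complete (n k : ℕ) (hk : 3 ≤ k) (hkn : k ≤ n - 1) :
    Module.finrank ℚ (homologyOf (cycBnd n (completeIn n k) (n - k + 1))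
      (cycBnd n (completeIn n k) (n - k))) = Nat.choose n (n - k) := by
  obtain ⟨m, hm⟩ : ∃ m, n - k = m + 1 := ⟨n - k - 1, by omega⟩
  rw [← Nat.choose_symm (show n - k ≤ n by omega), hm, show n - (m + 1) = k by omega,
    ← finrank_ker_cycBnd (n := n) (k := k) (m := m) (by omega) hk]
  have : IsEmpty (CycBas n (completeIn n k) (m + 1 + 1 + 1)) := isEmpty_cycBas (by omega)
  refine (Submodule.quotEquivOfEqBot _ ?_).finrank_eq
  rw [LinearMap.range_eq_bot.2 (Subsingleton.elim _ _), Submodule.comap_bot, Submodule.ker_subtype]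
end

section
/- Let n ≥ 4 and let H be the complete (n−1)-uniform hypergraph on {1,...,n}. Then dim HC_0(Δ(H)) = n and dim HC_{−1}(Δ(H)) = 1. -/
open Function

/-- The homology of two zero maps is the whole middle space. -/
theorem finrank_homologyOf_of_eq_zero {R A B C : Type} [CommRing R] [AddCommGroup A]
    [AddCommGroup B] [AddCommGroup C] [Module R A] [Module R B] [Module R C]
    {d2 : A →ₗ[R] B} {d1 : B →ₗ[R] C} (h2 : d2 = 0) (h1 : d1 = 0) :
    Module.finrank R (homologyOf d2 d1) = Module.finrank R B := by
  subst h2 h1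
  have hbot : (LinearMap.range (0 : A →ₗ[R] B)).comap
      (LinearMap.ker (0 : B →ₗ[R] C)).subtype = ⊥ := by
    rw [LinearMap.range_zero, Submodule.comap_bot, Submodule.ker_subtype]
  rw [(Submodule.quotEquivOfEqBot _ hbot).finrank_eq, LinearMap.ker_zero, finrank_top]

/-- A face of the complex of the complete `(n-1)`-uniform hypergraph is constant away from
a single vertex. -/
theorem exists_forall_ne_eq_of_completeIn {n m : ℕ} (hn : 1 ≤ n) {f : Fin n → Fin m}
    (hf : completeIn n (n - 1) m f) : ∃ x i, ∀ y, y ≠ x → f y = i := by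
  obtain ⟨e, he, i, hi⟩ := hf
  have hc : eᶜ.card = 1 := by
    rw [Finset.card_compl, he, Fintype.card_fin]
    omega
  obtain ⟨x, hx⟩ := Finset.card_eq_one.1 hc
  refine ⟨x, i, fun y hy => hi y ?_⟩
  by_contra hye
  have : y ∈ eᶜ := Finset.mem_compl.2 hye
  rw [hx, Finset.mem_singleton] at this
  exact hy this

/-- A function which is constant away from a single vertex satisfies the hyperedge condition
of the complete `(n-1)`-uniform hypergraph. -/
theorem completeIn_of_forall_ne_eq {n m : ℕ} {f : Fin n → Fin m} (x : Fin n) (i : Fin m)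
    (h : ∀ y, y ≠ x → f y = i) : completeIn n (n - 1) m f :=
  ⟨{x}ᶜ, by simp [Finset.card_compl], i, fun y hy => h y (by simpa using hy)⟩

theorem isEmpty_cycBas_three {n : ℕ} (hn : 1 ≤ n) :
    IsEmpty (CycBas n (completeIn n (n - 1)) 3) := by
  refine ⟨fun ⟨f, hsurj, _, hf⟩ => ?_⟩
  obtain ⟨x, i, hi⟩ := exists_forall_ne_eq_of_completeIn hn hf
  have hsub : (Finset.univ : Finset (Fin 3)) ⊆ {i, f x} := by
    intro k _
    obtain ⟨y, rfl⟩ := hsurj k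
    by_cases hy : y = x
    · simp [hy]
    · simp [hi y hy]
  have := (Finset.card_le_card hsub).trans Finset.card_le_two
  simp at this

theorem isEmpty_cycBas_zero {n : ℕ} (hn : 1 ≤ n) (P : (m : ℕ) → (Fin n → Fin m) → Prop) :
    IsEmpty (CycBas n P 0) :=
  ⟨fun f => (f.1 ⟨0, hn⟩).elim0⟩

theorem card_cycBas_one {n : ℕ} (hn : 1 ≤ n) :
    Fintype.card (CycBas n (completeIn n (n - 1)) 1) = 1 := by
  refine Fintype.card_eq_one_iff.2 ⟨⟨fun _ => 0, fun k => ⟨⟨0, hn⟩, Subsingleton.elim _ _⟩,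
    fun _ _ => rfl, completeIn_of_forall_ne_eq ⟨0, hn⟩ 0 fun _ _ => rfl⟩, fun f => ?_⟩
  exact Subtype.ext (funext fun _ => Subsingleton.elim _ _)

/-- The two-block partition that isolates the vertex `x`, with the vertex `0` in the first
block. -/
def isolate {n : ℕ} (x y : Fin n) : Fin 2 :=
  if y = x ↔ (x : ℕ) = 0 then 0 else 1

theorem isolate_injective {n : ℕ} (hn : 3 ≤ n) : Injective (isolate (n := n)) := by
  intro x x' h
  by_contra hne
  obtain ⟨z, hz⟩ : ∃ z : Fin n, z ∉ ({x, x'} : Finset (Fin n)) := by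
    by_contra! hall
    have h1 := Finset.card_le_card (fun z _ => hall z : Finset.univ ⊆ ({x, x'} : Finset (Fin n)))
    have h2 := h1.trans Finset.card_le_two
    simp at h2
    omega
  simp only [Finset.mem_insert, Finset.mem_singleton, not_or] at hz
  have hx := congrFun h x
  have hx' := congrFun h x'
  have hzz := congrFun h z
  simp only [isolate, hz.1, hz.2, hne, Ne.symm hne] at hx hx' hzz
  by_cases h0 : (x : ℕ) = 0 <;> by_cases h0' : (x' : ℕ) = 0 <;> simp_all

theorem isolate_mem {n : ℕ} (hn : 2 ≤ n) (x : Fin n) :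
    Surjective (isolate x) ∧ (∀ y : Fin n, (y : ℕ) = 0 → (isolate x y : ℕ) = 0) ∧
      completeIn n (n - 1) 2 (isolate x) := by
  refine ⟨?_, fun y hy => ?_, ?_⟩
  · obtain ⟨z, hz⟩ : ∃ z : Fin n, z ≠ x :=
      have : Nontrivial (Fin n) := Fin.nontrivial_iff_two_le.2 hn
      exists_ne x
    intro k
    by_cases h0 : (x : ℕ) = 0 <;> fin_cases k
    · exact ⟨x, by simp [isolate, h0]⟩
    · exact ⟨z, by simp [isolate, h0, hz]⟩
    · exact ⟨z, by simp [isolate, h0, hz]⟩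
    · exact ⟨x, by simp [isolate, h0]⟩
  · have : y = x ↔ (x : ℕ) = 0 := by rw [Fin.ext_iff]; omega
    simp [isolate, this]
  · refine completeIn_of_forall_ne_eq x (if (x : ℕ) = 0 then 1 else 0) fun y hy => ?_
    by_cases h0 : (x : ℕ) = 0 <;> simp [isolate, hy, h0]

theorem exists_isolate_eq {n : ℕ} (hn : 1 ≤ n) (f : CycBas n (completeIn n (n - 1)) 2) :
    ∃ x, isolate x = f.1 := by
  obtain ⟨f, hsurj, hzero, hf⟩ := f
  obtain ⟨x, i, hi⟩ := exists_forall_ne_eq_of_completeIn hn hf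
  have hxi : f x ≠ i := by
    intro hxi
    obtain ⟨y, hy⟩ := hsurj (i + 1)
    have : f y = i := by
      by_cases hyx : y = x
      · rw [hyx, hxi]
      · exact hi y hyx
    rw [this] at hy
    fin_cases i <;> simp at hy
  refine ⟨x, funext fun y => ?_⟩
  by_cases h0 : (x : ℕ) = 0
  · have hx := hzero x h0
    by_cases hy : y = x
    · subst hy
      simp only [isolate, h0]
      ext
      simp [hx]
    · change isolate x y = f y
      rw [hi y hy]
      simp only [isolate, hy, h0]
      ext
      simp
      omega
  · have hx0 : (⟨0, hn⟩ : Fin n) ≠ x := fun h => h0 (by rw [← h])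
    have hi0 : (i : ℕ) = 0 := by rw [← hi _ hx0]; exact hzero _ rfl
    by_cases hy : y = x
    · subst hy
      simp only [isolate, h0]
      ext
      simp
      omega
    · change isolate x y = f y
      rw [hi y hy]
      simp only [isolate, hy, h0]
      ext
      simp [hi0]

theorem card_cycBas_two {n : ℕ} (hn : 3 ≤ n) :
    Fintype.card (CycBas n (completeIn n (n - 1)) 2) = n := by
  let toFace : Fin n → CycBas n (completeIn n (n - 1)) 2 :=
    fun x => ⟨isolate x, isolate_mem (by omega) x⟩
  have hbij : Bijective toFace := by
    refine ⟨fun x y h => isolate_injective hn (congrArg Subtype.val h), fun f => ?_⟩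
    obtain ⟨x, hx⟩ := exists_isolate_eq (by omega) f
    exact ⟨x, Subtype.ext hx⟩
  rw [← Fintype.card_of_bijective hbij, Fintype.card_fin]

/-- The two ways of merging the blocks of a two-block partition cancel. -/
theorem cycBnd_one (n : ℕ) (P : (m : ℕ) → (Fin n → Fin m) → Prop) : cycBnd n P 1 = 0 := by
  have hmat : cycMat n P 1 = 0 := by
    funext f g
    have h1 : mergeMap (0 : Fin 1) ∘ f.1 = g.1 := funext fun _ => Subsingleton.elim _ _
    have h2 : ∀ y : Fin n, ((f.1 y : ℕ) = 1 → (g.1 y : ℕ) = 0) ∧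
        ((f.1 y : ℕ) ≠ 1 → (g.1 y : ℕ) = (f.1 y : ℕ)) := fun y => by omega
    simp only [cycMat, Fin.sum_univ_one, if_pos h1, if_pos h2]
    simp
  ext c g
  simp [cycBnd, matLin, hmat]

/-- Theorem (paper Thm. `special_case_1`): for the complete `(n-1)`-uniform hypergraph `H`
on `n ≥ 4` vertices, `dim HC_0(Δ(H)) = n` and `dim HC_{-1}(Δ(H)) = 1`.
Homological degree `r` corresponds to partitions with `r+2` blocks. -/
theorem dim_HC_cyclic_complete_unif_pred (n : ℕ) (hn : 4 ≤ n) :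
    Module.finrank ℚ (homologyOf (cycBnd n (completeIn n (n - 1)) 2)
        (cycBnd n (completeIn n (n - 1)) 1)) = n ∧
    Module.finrank ℚ (homologyOf (cycBnd n (completeIn n (n - 1)) 1)
        (cycBnd n (completeIn n (n - 1)) 0)) = 1 := by
  have h3 := isEmpty_cycBas_three (n := n) (by omega)
  have h0 := isEmpty_cycBas_zero (n := n) (by omega) (completeIn n (n - 1))
  constructor
  · rw [finrank_homologyOf_of_eq_zero (Subsingleton.elim _ _) (cycBnd_one _ _),
      Module.finrank_fintype_fun_eq_card, card_cycBas_two (by omega)]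
  · rw [finrank_homologyOf_of_eq_zero (cycBnd_one _ _) (Subsingleton.elim _ _),
      Module.finrank_fintype_fun_eq_card, card_cycBas_one (by omega)]
end
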